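/- If u is a strong solution of ∂_t u = (1/2) u ∂_x² u on a time interval [0,T), then u(t,·) is differentiable on ℝ for every t ∈ (0,T), and for all 0 < T₁ ≤ T₂ < T one has sup_{t∈[T₁,T₂]} Lip ∂_x u(t,·) < ∞ (equivalently, ∂_x² u is essentially bounded on [T₁,T₂] × ℝ). If moreover u(0,·) is differentiable with Lipschitz derivative, then the same conclusion holds with T₁ = 0. -/

import Mathlib

open MeasureTheory Set Filter

noncomputable section

/-- Regularity requirements in the definition of a weak solution of
`∂ₜ u = (1/2) u ∂ₓ² u` on `[0,T) × ℝ`: continuity on `[0,T) × ℝ`, local Lipschitz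
continuity of `u(t,·)`, and continuity of `t ↦ u(t,·)` into `W^{1,∞}_loc(ℝ)`. -/
def RegWeak (T : ℝ) (u : ℝ → ℝ → ℝ) : Prop :=
  ContinuousOn (Function.uncurry u) (Ico 0 T ×ˢ (univ : Set ℝ)) ∧
  (∀ t ∈ Ico (0:ℝ) T, ∀ R : ℝ, 0 < R →
    ∃ L : NNReal, LipschitzOnWith L (u t) (Icc (-R) R)) ∧
  (∀ t₀ ∈ Ico (0:ℝ) T, ∀ R : ℝ, 0 < R →
    Tendsto (fun t => ⨆ x : Icc (-R) R,
        (|u t x.1 - u t₀ x.1| + |deriv (u t) x.1 - deriv (u t₀) x.1|))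
      (nhdsWithin t₀ (Ico 0 T)) (nhds 0))

/-- The weak (integral) formulation of `∂ₜ u = (1/2) u ∂ₓ² u` on `[0,T) × ℝ`,
tested against every `ψ ∈ C_c^∞([0,T) × ℝ)`. -/
def WeakForm (T : ℝ) (u : ℝ → ℝ → ℝ) : Prop :=
  ∀ ψ : ℝ → ℝ → ℝ,
    ContDiff ℝ (⊤ : ℕ∞) (Function.uncurry ψ) →
    HasCompactSupport (Function.uncurry ψ) →
    tsupport (Function.uncurry ψ) ⊆ Iio T ×ˢ (univ : Set ℝ) →
    (∫ x : ℝ, u 0 x * ψ 0 x) +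
      (∫ t in Ico (0:ℝ) T, ∫ x : ℝ,
        (u t x * deriv (fun s => ψ s x) t
          - (1/2) * deriv (fun y => ψ t y * u t y) x * deriv (u t) x)) = 0

/-- A weak solution of `∂ₜ u = (1/2) u ∂ₓ² u` on `[0,T) × ℝ`. -/
def IsWeakSolution (T : ℝ) (u : ℝ → ℝ → ℝ) : Prop :=
  (∀ t ∈ Ico (0:ℝ) T, ∀ x : ℝ, 0 ≤ u t x) ∧ RegWeak T u ∧ WeakForm T u

/-- `sup_{[0,T']×ℝ} ⟨x⟩⁻² u < ∞`, i.e. `u(t,x) ≤ M (x²+1)` on `[0,T'] × ℝ`. -/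
def QuadBoundOn (u : ℝ → ℝ → ℝ) (T' : ℝ) : Prop :=
  ∃ M : ℝ, ∀ t ∈ Icc (0:ℝ) T', ∀ x : ℝ, u t x ≤ M * (x ^ 2 + 1)

/-- For a.e. `t ∈ (0,T']` the function `u(t,·)` is twice differentiable, and
`t ↦ ess sup_x |∂ₓ² u(t,x)|` is integrable on `[0,T']` (expressed via an
integrable majorant `g`). -/
def SecondDerivIntegrableOn (u : ℝ → ℝ → ℝ) (T' : ℝ) : Prop :=
  ∃ g : ℝ → ℝ, IntegrableOn g (Icc (0:ℝ) T') ∧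
    ∀ᵐ t ∂(volume.restrict (Ioc (0:ℝ) T')),
      (∀ x : ℝ, DifferentiableAt ℝ (u t) x ∧ DifferentiableAt ℝ (deriv (u t)) x) ∧
      (∀ x : ℝ, |deriv (deriv (u t)) x| ≤ g t)

/-- A strong solution of `∂ₜ u = (1/2) u ∂ₓ² u` on `[0,T) × ℝ`. -/
def IsStrongSolution (T : ℝ) (u : ℝ → ℝ → ℝ) : Prop :=
  IsWeakSolution T u ∧
  ∀ T' : ℝ, 0 < T' → T' < T → QuadBoundOn u T' ∧ SecondDerivIntegrableOn u T'

/-- A convex function of quadratic growth, vanishing on `(-∞, 0]` and cubic at `0`. -/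
def truncSq (z : ℝ) : ℝ := max z 0 ^ 3 / (1 + max z 0)

/-- The derivative of `truncSq`. -/
def truncSqD (z : ℝ) : ℝ := (3 * max z 0 ^ 2 + 2 * max z 0 ^ 3) / (1 + max z 0) ^ 2

/-- The second derivative of `truncSq`. -/
def truncSqDD (z : ℝ) : ℝ :=
  2 * (3 * max z 0 + 3 * max z 0 ^ 2 + max z 0 ^ 3) / (1 + max z 0) ^ 3

lemma one_add_max_pos (z : ℝ) : 0 < 1 + max z 0 := by positivity

lemma hasDerivAt_zero_of_abs_le_sq {f : ℝ → ℝ} {C : ℝ} (hf : ∀ z, |f z| ≤ C * z ^ 2) :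
    HasDerivAt f 0 0 := by
  have h0 : f 0 = 0 := by simpa using hf 0
  rw [hasDerivAt_iff_isLittleO]
  have h1 : (fun z : ℝ => f z - f 0 - (z - 0) • (0 : ℝ)) =O[nhds 0] fun z : ℝ => z ^ 2 := by
    refine Asymptotics.IsBigO.of_bound C (Eventually.of_forall fun z => ?_)
    simpa [h0] using hf z
  refine h1.trans_isLittleO ?_
  simpa using Asymptotics.isLittleO_pow_id (𝕜 := ℝ) (n := 2) (by norm_num)

lemma hasDerivAt_max_zero_comp {F F' : ℝ → ℝ} {C : ℝ}
    (hF : ∀ z, 0 < z → HasDerivAt F (F' z) z) (h0' : F' 0 = 0)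
    (hC : ∀ z, 0 ≤ z → |F z| ≤ C * z ^ 2) (z : ℝ) :
    HasDerivAt (fun z => F (max z 0)) (F' (max z 0)) z := by
  rcases lt_trichotomy z 0 with h | h | h
  · rw [max_eq_right h.le, h0']
    refine (hasDerivAt_const z (F 0)).congr_of_eventuallyEq ?_
    filter_upwards [gt_mem_nhds h] with y hy
    rw [max_eq_right hy.le]
  · subst h
    rw [max_self, h0']
    refine hasDerivAt_zero_of_abs_le_sq (C := C) fun z => (hC _ (le_max_right z 0)).trans ?_
    have hC0 : 0 ≤ C := by simpa using (abs_nonneg _).trans (hC 1 zero_le_one)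
    refine mul_le_mul_of_nonneg_left ?_ hC0
    rcases le_total z 0 with h | h
    · rw [max_eq_right h, zero_pow two_ne_zero]; positivity
    · rw [max_eq_left h]
  · rw [max_eq_left h.le]
    refine (hF z h).congr_of_eventuallyEq ?_
    filter_upwards [lt_mem_nhds h] with y hy
    rw [max_eq_left hy.le]

lemma hasDerivAt_truncSq (z : ℝ) : HasDerivAt truncSq (truncSqD z) z := by
  refine hasDerivAt_max_zero_comp (F := fun p => p ^ 3 / (1 + p))
    (F' := fun p => (3 * p ^ 2 + 2 * p ^ 3) / (1 + p) ^ 2) (C := 1) ?_ (by simp) ?_ z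
  · intro p hp
    have h := (hasDerivAt_pow 3 p).div ((hasDerivAt_id p).const_add 1) (by simp; positivity)
    refine h.congr_deriv ?_
    simp
    ring
  · intro p hp
    rw [abs_of_nonneg (by positivity), div_le_iff₀ (by positivity)]
    nlinarith [pow_nonneg hp 3, pow_nonneg hp 2]

lemma hasDerivAt_truncSqD (z : ℝ) : HasDerivAt truncSqD (truncSqDD z) z := by
  refine hasDerivAt_max_zero_comp (F := fun p => (3 * p ^ 2 + 2 * p ^ 3) / (1 + p) ^ 2)
    (F' := fun p => 2 * (3 * p + 3 * p ^ 2 + p ^ 3) / (1 + p) ^ 3) (C := 3) ?_ (by simp) ?_ z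
  · intro p hp
    have h := (((hasDerivAt_pow 2 p).const_mul 3).add ((hasDerivAt_pow 3 p).const_mul 2)).div
      (((hasDerivAt_id p).const_add 1).pow 2) (by simp; positivity)
    refine h.congr_deriv ?_
    have : (1 + p) ≠ 0 := by positivity
    simp
    field_simp
    ring
  · intro p hp
    rw [abs_of_nonneg (by positivity), div_le_iff₀ (by positivity)]
    nlinarith [pow_nonneg hp 3, pow_nonneg hp 2, pow_nonneg hp 4]

lemma continuous_truncSq : Continuous truncSq :=
  continuous_iff_continuousAt.2 fun z => (hasDerivAt_truncSq z).continuousAt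

lemma continuous_truncSqD : Continuous truncSqD :=
  continuous_iff_continuousAt.2 fun z => (hasDerivAt_truncSqD z).continuousAt

lemma continuous_truncSqDD : Continuous truncSqDD := by
  unfold truncSqDD
  refine Continuous.div (by fun_prop) (by fun_prop) fun z => ?_
  have := one_add_max_pos z
  positivity

lemma truncSq_nonneg (z : ℝ) : 0 ≤ truncSq z := by unfold truncSq; positivity

lemma truncSqD_nonneg (z : ℝ) : 0 ≤ truncSqD z := by unfold truncSqD; positivity

lemma truncSqDD_nonneg (z : ℝ) : 0 ≤ truncSqDD z := by unfold truncSqDD; positivity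

lemma truncSq_of_nonpos {z : ℝ} (hz : z ≤ 0) : truncSq z = 0 := by
  simp [truncSq, max_eq_right hz]

lemma truncSqD_of_nonpos {z : ℝ} (hz : z ≤ 0) : truncSqD z = 0 := by
  simp [truncSqD, max_eq_right hz]

lemma nonpos_of_truncSq_eq_zero {z : ℝ} (hz : truncSq z = 0) : z ≤ 0 := by
  by_contra! h
  have : 0 < truncSq z := by
    unfold truncSq
    rw [max_eq_left h.le]
    positivity
  exact this.ne' hz

lemma truncSq_le_sq (z : ℝ) : truncSq z ≤ z ^ 2 := by
  rcases le_total z 0 with h | h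
  · rw [truncSq_of_nonpos h]; positivity
  · unfold truncSq
    rw [max_eq_left h, div_le_iff₀ (by positivity)]
    nlinarith [pow_nonneg h 2]

lemma mul_truncSqD_le (z : ℝ) : z * truncSqD z ≤ 3 * truncSq z := by
  rcases le_total z 0 with h | h
  · rw [truncSq_of_nonpos h, truncSqD_of_nonpos h]; simp
  · unfold truncSq truncSqD
    rw [max_eq_left h, ← mul_div_assoc, ← mul_div_assoc,
      div_le_div_iff₀ (by positivity) (by positivity)]
    have : 0 ≤ z ^ 4 * (1 + z) := by positivity
    nlinarith

lemma truncSqDD_le (z : ℝ) : truncSqDD z ≤ 2 := by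
  unfold truncSqDD
  rw [div_le_iff₀ (by positivity)]
  nlinarith

lemma truncSqD_sq_le (z : ℝ) : truncSqD z ^ 2 ≤ 2 * (truncSq z * truncSqDD z) := by
  unfold truncSq truncSqD truncSqDD
  have hp : 0 ≤ max z 0 := le_max_right _ _
  set p := max z 0
  have h1 : (p ^ 3 / (1 + p)) * (2 * (3 * p + 3 * p ^ 2 + p ^ 3) / (1 + p) ^ 3)
      = 2 * p ^ 4 * (3 + 3 * p + p ^ 2) / (1 + p) ^ 4 := by
    field_simp
  rw [h1, div_pow, ← pow_mul, ← mul_div_assoc, div_le_div_iff_of_pos_right (by positivity)]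
  nlinarith [pow_nonneg hp 4]

/-- The quadratic inequality that absorbs the cross term into the dissipation. -/
lemma neg_dissipation_le {z X q' R : ℝ} (hR : 0 < R) (hq : q' ^ 2 ≤ 4 / R ^ 2) :
    -(truncSqDD z * X ^ 2) - 2 * (truncSqD z * X * q') ≤ 8 / R ^ 2 * truncSq z := by
  have h1 := truncSqD_sq_le z
  have h2 := truncSqDD_nonneg z
  have h3 := truncSq_nonneg z
  have h4 : (truncSqD z * q') ^ 2 ≤ truncSqDD z * (8 / R ^ 2 * truncSq z) := by
    calc (truncSqD z * q') ^ 2 = truncSqD z ^ 2 * q' ^ 2 := by ring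
      _ ≤ (2 * (truncSq z * truncSqDD z)) * (4 / R ^ 2) := by gcongr
      _ = _ := by ring
  rcases h2.eq_or_lt with h | h
  · have h5 : truncSqD z * q' = 0 := by
      rw [← h, zero_mul] at h4
      exact pow_eq_zero_iff two_ne_zero |>.1 (le_antisymm h4 (sq_nonneg _))
    have h6 : truncSqD z * X * q' = 0 := by rw [mul_right_comm, h5, zero_mul]
    rw [h6, ← h]
    have : 0 ≤ 8 / R ^ 2 * truncSq z := by positivity
    linarith
  · have h7 : 0 ≤ truncSqDD z * (8 / R ^ 2 * truncSq z + truncSqDD z * X ^ 2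
        + 2 * (truncSqD z * X * q')) := by
      nlinarith [sq_nonneg (truncSqDD z * X + truncSqD z * q')]
    have := nonneg_of_mul_nonneg_right h7 h
    linarith

/-- The `C¹` cutoff `(1 - x² / R²)²`, used on `[-R, R]`. -/
def bump (R x : ℝ) : ℝ := (1 - x ^ 2 / R ^ 2) ^ 2

/-- The derivative of `bump R`. -/
def bumpD (R x : ℝ) : ℝ := 2 * (1 - x ^ 2 / R ^ 2) * (-(2 * x) / R ^ 2)

lemma hasDerivAt_bump (R x : ℝ) : HasDerivAt (bump R) (bumpD R x) x := by
  have h := (((hasDerivAt_pow 2 x).div_const (R ^ 2)).const_sub 1).pow 2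
  refine h.congr_deriv ?_
  simp [bumpD]
  ring

@[fun_prop]
lemma continuous_bump (R : ℝ) : Continuous (bump R) := by
  unfold bump; fun_prop

@[fun_prop]
lemma continuous_bumpD (R : ℝ) : Continuous (bumpD R) := by
  unfold bumpD; fun_prop

lemma bump_nonneg (R x : ℝ) : 0 ≤ bump R x := by unfold bump; positivity

lemma sq_div_sq_le_one {R x : ℝ} (hR : 0 < R) (hx : x ∈ Icc (-R) R) : x ^ 2 / R ^ 2 ≤ 1 := by
  rw [div_le_one (by positivity)]
  exact sq_le_sq' hx.1 hx.2

lemma bump_le_one {R x : ℝ} (hR : 0 < R) (hx : x ∈ Icc (-R) R) : bump R x ≤ 1 := by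
  have h1 := sq_div_sq_le_one hR hx
  have h2 : 0 ≤ x ^ 2 / R ^ 2 := by positivity
  unfold bump
  exact pow_le_one₀ (by linarith) (by linarith)

lemma abs_bumpD_le {R x : ℝ} (hR : 1 ≤ R) (hx : x ∈ Icc (-R) R) : |bumpD R x| ≤ 4 := by
  have hR0 : 0 < R := by linarith
  have h1 := sq_div_sq_le_one hR0 hx
  have h2 : 0 ≤ x ^ 2 / R ^ 2 := by positivity
  have h3 : |2 * x / R ^ 2| ≤ 2 := by
    rw [abs_div, abs_mul, abs_two, abs_of_pos (by positivity : 0 < R ^ 2),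
      div_le_iff₀ (by positivity)]
    have := abs_le.2 hx
    nlinarith
  have h4 : |1 - x ^ 2 / R ^ 2| ≤ 1 := by rw [abs_le]; constructor <;> linarith
  unfold bumpD
  rw [abs_mul, abs_mul, neg_div, abs_neg, abs_two]
  nlinarith [abs_nonneg (1 - x ^ 2 / R ^ 2), abs_nonneg (2 * x / R ^ 2)]

attribute [fun_prop] continuous_truncSq continuous_truncSqD continuous_truncSqDD

lemma neg_dissipation_bump_le {R x z D' : ℝ} (hR : 1 ≤ R) (hx : x ∈ Icc (-R) R) :
    -((truncSqDD z * D' * bump R x + truncSqD z * bumpD R x) * D') ≤ 8 / R ^ 2 * truncSq z := by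
  have hR0 : 0 < R := by linarith
  have h1 := sq_div_sq_le_one hR0 hx
  have hq : (-(2 * x) / R ^ 2) ^ 2 ≤ 4 / R ^ 2 := by
    calc (-(2 * x) / R ^ 2) ^ 2 = 4 / R ^ 2 * (x ^ 2 / R ^ 2) := by field_simp; ring
      _ ≤ 4 / R ^ 2 * 1 := by gcongr
      _ = _ := mul_one _
  have h := neg_dissipation_le (z := z) (X := D' * (1 - x ^ 2 / R ^ 2)) hR0 hq
  refine le_trans (le_of_eq ?_) h
  unfold bump bumpD
  ring

/-- Energy inequality in one variable, on an interval on which the comparison function is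
`W ξ - κ ξ + c`. -/
lemma energy_inequality_piece {R p q κ c δ P Q : ℝ} {u w W W' V V' : ℝ → ℝ} (hR : 1 ≤ R)
    (hpq : p ≤ q) (hp : -R ≤ p) (hq : q ≤ R)
    (hu : ∀ x, HasDerivAt u (w x) x) (hw : Continuous w)
    (hW : ∀ x, HasDerivAt W (W' x) x) (hW' : Continuous W')
    (hV : ∀ x, HasDerivAt V (V' x) x) (hV' : Continuous V') (hu0 : ∀ x, 0 ≤ u x)
    (hfp : truncSqD (W p - κ * p + c) * bump R p = 0)
    (hfq : truncSqD (W q - κ * q + c) * bump R q = 0)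
    (he : ∀ x ∈ Icc (-R) R, |V x - u x * W' x| ≤ δ) (hP : ∀ x ∈ Icc (-R) R, |W' x| ≤ P)
    (hQ : ∀ x ∈ Icc p q, truncSqD (W x - κ * x + c) ≤ Q) :
    ∫ x in p..q, truncSqD (W x - κ * x + c) * bump R x * V' x ≤
      κ * (∫ x in p..q, truncSqD (W x - κ * x + c) * bump R x * w x) +
      8 / R ^ 2 * (∫ x in p..q, u x * truncSq (W x - κ * x + c)) +
      (q - p) * (δ * (2 * (P + |κ|) + 4 * Q)) := by
  have hWc : Continuous W := continuous_iff_continuousAt.2 fun x => (hW x).continuousAt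
  have huc : Continuous u := continuous_iff_continuousAt.2 fun x => (hu x).continuousAt
  have hVc : Continuous V := continuous_iff_continuousAt.2 fun x => (hV x).continuousAt
  set D : ℝ → ℝ := fun x => W x - κ * x + c with hD
  have hDd : ∀ x, HasDerivAt D (W' x - κ) x := fun x =>
    (((hW x).sub ((hasDerivAt_id x).const_mul κ)).add_const c).congr_deriv (by simp)
  have hDc : Continuous D := by fun_prop
  set f : ℝ → ℝ := fun x => truncSqD (D x) * bump R x with hf
  set f' : ℝ → ℝ := fun x => truncSqDD (D x) * (W' x - κ) * bump R x + truncSqD (D x) * bumpD R x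
    with hf'
  have hfd : ∀ x, HasDerivAt f (f' x) x := fun x =>
    ((hasDerivAt_truncSqD (D x)).comp x (hDd x)).mul (hasDerivAt_bump R x)
  have hfc : Continuous f := by fun_prop
  have hfc' : Continuous f' := by fun_prop
  have i1 : ∫ x in p..q, f x * V' x = - ∫ x in p..q, f' x * V x := by
    rw [intervalIntegral.integral_mul_deriv_eq_deriv_mul (fun x _ => hfd x) (fun x _ => hV x)
      (hfc'.intervalIntegrable _ _) (hV'.intervalIntegrable _ _)]
    simp only [hf, hD] at hfp hfq ⊢
    rw [hfp, hfq]; ring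
  have i2 : ∫ x in p..q, f x * w x = - ∫ x in p..q, f' x * u x := by
    rw [intervalIntegral.integral_mul_deriv_eq_deriv_mul (fun x _ => hfd x) (fun x _ => hu x)
      (hfc'.intervalIntegrable _ _) (hw.intervalIntegrable _ _)]
    simp only [hf, hD] at hfp hfq ⊢
    rw [hfp, hfq]; ring
  have key : ∫ x in p..q, (κ * (f' x * u x) - f' x * V x) ≤
      ∫ x in p..q, (8 / R ^ 2 * (u x * truncSq (D x)) + δ * (2 * (P + |κ|) + 4 * Q)) := by
    refine intervalIntegral.integral_mono_on hpq (Continuous.intervalIntegrable (by fun_prop) _ _)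
      (Continuous.intervalIntegrable (by fun_prop) _ _) fun x hx => ?_
    have hxR : x ∈ Icc (-R) R := ⟨hp.trans hx.1, hx.2.trans hq⟩
    have hQx : truncSqD (D x) ≤ Q := hQ x hx
    have e1 : κ * (f' x * u x) - f' x * V x
        = u x * -(f' x * (W' x - κ)) + -(f' x * (V x - u x * W' x)) := by ring
    rw [e1]
    have e2 : u x * -(f' x * (W' x - κ)) ≤ u x * (8 / R ^ 2 * truncSq (D x)) :=
      mul_le_mul_of_nonneg_left (neg_dissipation_bump_le hR hxR) (hu0 x)
    have e3 : |f' x| ≤ 2 * (P + |κ|) + 4 * Q := by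
      have a1 : |W' x - κ| ≤ P + |κ| := (abs_sub _ _).trans (by gcongr; exact hP x hxR)
      have a2 := truncSqDD_nonneg (D x)
      have a3 := truncSqDD_le (D x)
      have a4 := truncSqD_nonneg (D x)
      have a5 := bump_nonneg R x
      have a6 := bump_le_one (by linarith) hxR
      refine (abs_add_le _ _).trans ?_
      rw [abs_mul, abs_mul, abs_mul, abs_of_nonneg a2, abs_of_nonneg a4, abs_of_nonneg a5]
      have b1 : truncSqDD (D x) * |W' x - κ| * bump R x ≤ 2 * (P + |κ|) * 1 := by
        have := (abs_nonneg _).trans a1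
        gcongr
      have b2 : truncSqD (D x) * |bumpD R x| ≤ Q * 4 :=
        mul_le_mul hQx (abs_bumpD_le hR hxR) (abs_nonneg _) (a4.trans hQx)
      linarith
    have e4 : -(f' x * (V x - u x * W' x)) ≤ δ * (2 * (P + |κ|) + 4 * Q) := by
      refine (neg_le_abs _).trans ?_
      rw [abs_mul, mul_comm]
      exact mul_le_mul (he x hxR) e3 (abs_nonneg _) ((abs_nonneg _).trans (he x hxR))
    linarith
  rw [intervalIntegral.integral_sub (Continuous.intervalIntegrable (by fun_prop) _ _)
    (Continuous.intervalIntegrable (by fun_prop) _ _), intervalIntegral.integral_add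
    (Continuous.intervalIntegrable (by fun_prop) _ _)
    (Continuous.intervalIntegrable (by fun_prop) _ _), intervalIntegral.integral_const_mul,
    intervalIntegral.integral_const_mul, intervalIntegral.integral_const, smul_eq_mul] at key
  have e5 : ∫ x in p..q, f x * V' x ≤ κ * (∫ x in p..q, f x * w x) +
      8 / R ^ 2 * (∫ x in p..q, u x * truncSq (D x)) +
      (q - p) * (δ * (2 * (P + |κ|) + 4 * Q)) := by
    rw [i1, i2]; linarith
  exact e5

/-- `truncSqD (g p)` multiplied by the sign of `h p`. -/
def signedD (g h : ℝ) : ℝ := if 0 ≤ h then truncSqD g else -truncSqD g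

lemma continuous_signedD {X : Type*} [TopologicalSpace X] {g h : X → ℝ} (hg : Continuous g)
    (hh : Continuous h) (h0 : ∀ p, h p = 0 → g p ≤ 0) :
    Continuous fun p => signedD (g p) (h p) := by
  unfold signedD
  refine Continuous.if_le (by fun_prop) (by fun_prop) continuous_const hh fun p hp => ?_
  rw [truncSqD_of_nonpos (h0 p hp.symm), neg_zero]

lemma signedD_mul_le (g h z : ℝ) : signedD g h * z ≤ truncSqD g * |z| := by
  unfold signedD
  have := truncSqD_nonneg g
  split_ifs
  · gcongr; exact le_abs_self z
  · rw [neg_mul, ← mul_neg]; gcongr; exact neg_le_abs z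

lemma signedD_swap (g h : ℝ) (h0 : h = 0 → g ≤ 0) : signedD g (-h) = -signedD g h := by
  unfold signedD
  rcases lt_trichotomy h 0 with h1 | h1 | h1
  · rw [if_pos (by linarith), if_neg (by linarith), neg_neg]
  · simp [h1, truncSqD_of_nonpos (h0 h1)]
  · rw [if_neg (by linarith), if_pos h1.le]

/-- Energy inequality in one variable, for the comparison function
`W ξ - W y - K * |ξ - y|`. -/
lemma energy_inequality_line {R y K δ P Q : ℝ} {u w W W' V V' : ℝ → ℝ} (hR : 1 ≤ R)
    (hy : y ∈ Icc (-R) R) (hK : 0 ≤ K)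
    (hu : ∀ x, HasDerivAt u (w x) x) (hw : Continuous w)
    (hW : ∀ x, HasDerivAt W (W' x) x) (hW' : Continuous W')
    (hV : ∀ x, HasDerivAt V (V' x) x) (hV' : Continuous V') (hu0 : ∀ x, 0 ≤ u x)
    (he : ∀ x ∈ Icc (-R) R, |V x - u x * W' x| ≤ δ) (hP : ∀ x ∈ Icc (-R) R, |W' x| ≤ P)
    (hQ : ∀ x ∈ Icc (-R) R, truncSqD (W x - W y - K * |x - y|) ≤ Q) :
    ∫ x in (-R)..R, truncSqD (W x - W y - K * |x - y|) * bump R x * V' x ≤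
      K * (∫ x in (-R)..R, signedD (W x - W y - K * |x - y|) (x - y) * bump R x * w x) +
      8 / R ^ 2 * (∫ x in (-R)..R, u x * truncSq (W x - W y - K * |x - y|)) +
      (2 * R) * (δ * (2 * (P + K) + 4 * Q)) := by
  have hWc : Continuous W := continuous_iff_continuousAt.2 fun x => (hW x).continuousAt
  have huc : Continuous u := continuous_iff_continuousAt.2 fun x => (hu x).continuousAt
  have hR0 : R ≠ 0 := by linarith
  have hl : ∀ x ∈ Icc (-R) y, W x - -K * x + (-W y - K * y) = W x - W y - K * |x - y| := by
    intro x hx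
    rw [abs_of_nonpos (by linarith [hx.2])]; ring
  have hr : ∀ x ∈ Icc y R, W x - K * x + (-W y + K * y) = W x - W y - K * |x - y| := by
    intro x hx
    rw [abs_of_nonneg (by linarith [hx.1])]; ring
  have bR : bump R R = 0 := by simp [bump, hR0]
  have bL : bump R (-R) = 0 := by simp [bump, hR0]
  have L := energy_inequality_piece (κ := -K) (c := -W y - K * y) (Q := Q) hR hy.1 le_rfl hy.2 hu
    hw hW hW' hV hV' hu0 (by rw [bL, mul_zero])
    (by rw [hl y ⟨hy.1, le_rfl⟩, truncSqD_of_nonpos (by simp), zero_mul]) he hP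
    (fun x hx => by rw [hl x hx]; exact hQ x ⟨hx.1, hx.2.trans hy.2⟩)
  have U := energy_inequality_piece (κ := K) (c := -W y + K * y) (Q := Q) hR hy.2 hy.1 le_rfl hu
    hw hW hW' hV hV' hu0 (by rw [hr y ⟨le_rfl, hy.2⟩, truncSqD_of_nonpos (by simp), zero_mul])
    (by rw [bR, mul_zero]) he hP
    (fun x hx => by rw [hr x hx]; exact hQ x ⟨hy.1.trans hx.1, hx.2⟩)
  have cl : ∀ {F G : ℝ → ℝ}, (∀ x ∈ Icc (-R) y, F x = G x) →
      ∫ x in (-R)..y, F x = ∫ x in (-R)..y, G x := fun h =>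
    intervalIntegral.integral_congr fun x hx => h x (by rwa [uIcc_of_le hy.1] at hx)
  have cr : ∀ {F G : ℝ → ℝ}, (∀ x ∈ Icc y R, F x = G x) →
      ∫ x in y..R, F x = ∫ x in y..R, G x := fun h =>
    intervalIntegral.integral_congr fun x hx => h x (by rwa [uIcc_of_le hy.2] at hx)
  rw [cl (fun x hx => by rw [hl x hx]),
    cl (F := fun x => truncSqD (W x - -K * x + (-W y - K * y)) * bump R x * w x)
      (G := fun x => -(signedD (W x - W y - K * |x - y|) (x - y) * bump R x * w x))
      (fun x hx => by
        rw [hl x hx]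
        rcases hx.2.lt_or_eq with h | h
        · rw [signedD, if_neg (by linarith)]; ring
        · simp [signedD, h, truncSqD_of_nonpos le_rfl]),
    cl (F := fun x => u x * truncSq _) (fun x hx => by rw [hl x hx]),
    intervalIntegral.integral_neg, abs_neg, abs_of_nonneg hK] at L
  rw [cr (fun x hx => by rw [hr x hx]),
    cr (F := fun x => truncSqD (W x - K * x + (-W y + K * y)) * bump R x * w x)
      (G := fun x => signedD (W x - W y - K * |x - y|) (x - y) * bump R x * w x)
      (fun x hx => by rw [hr x hx, signedD, if_pos (by linarith [hx.1])]),
    cr (F := fun x => u x * truncSq _) (fun x hx => by rw [hr x hx]), abs_of_nonneg hK] at U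
  have hs : Continuous fun x => signedD (W x - W y - K * |x - y|) (x - y) :=
    continuous_signedD (by fun_prop) (by fun_prop) fun x hx => by
      rw [sub_eq_zero.1 hx]; simp
  have s1 := intervalIntegral.integral_add_adjacent_intervals (a := -R) (b := y) (c := R)
    (f := fun x => truncSqD (W x - W y - K * |x - y|) * bump R x * V' x) (μ := volume)
    (Continuous.intervalIntegrable (by fun_prop) _ _)
    (Continuous.intervalIntegrable (by fun_prop) _ _)
  have s2 := intervalIntegral.integral_add_adjacent_intervals (a := -R) (b := y) (c := R)
    (f := fun x => signedD (W x - W y - K * |x - y|) (x - y) * bump R x * w x) (μ := volume)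
    (Continuous.intervalIntegrable (by fun_prop) _ _)
    (Continuous.intervalIntegrable (by fun_prop) _ _)
  have s3 := intervalIntegral.integral_add_adjacent_intervals (a := -R) (b := y) (c := R)
    (f := fun x => u x * truncSq (W x - W y - K * |x - y|)) (μ := volume)
    (Continuous.intervalIntegrable (by fun_prop) _ _)
    (Continuous.intervalIntegrable (by fun_prop) _ _)
  rw [← s1, ← s2, ← s3]
  linarith

lemma intervalIntegral_swap_of_continuous {F : ℝ → ℝ → ℝ} (hF : Continuous (Function.uncurry F))
    (a b c d : ℝ) :
    ∫ x in a..b, ∫ y in c..d, F x y = ∫ y in c..d, ∫ x in a..b, F x y := by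
  refine intervalIntegral_intervalIntegral_swap ?_
  exact (hF.continuousOn.integrableOn_compact (isCompact_uIcc.prod isCompact_uIcc)).mono_set
    (prod_mono uIoc_subset_uIcc uIoc_subset_uIcc)

lemma intervalIntegral_iterated_mono {F G : ℝ → ℝ → ℝ} (hF : Continuous (Function.uncurry F))
    (hG : Continuous (Function.uncurry G)) {a b : ℝ} (hab : a ≤ b)
    (h : ∀ x ∈ Icc a b, ∀ y ∈ Icc a b, F x y ≤ G x y) :
    ∫ x in a..b, ∫ y in a..b, F x y ≤ ∫ x in a..b, ∫ y in a..b, G x y := by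
  refine intervalIntegral.integral_mono_on hab (Continuous.intervalIntegrable (by fun_prop) _ _)
    (Continuous.intervalIntegrable (by fun_prop) _ _) fun x hx => ?_
  exact intervalIntegral.integral_mono_on hab (Continuous.intervalIntegrable (by fun_prop) _ _)
    (Continuous.intervalIntegrable (by fun_prop) _ _) fun y hy => h x hx y hy

/-- One half of the energy inequality in two variables. -/
lemma energy_inequality_half {R K δ P Q N : ℝ} {u w W W' V V' : ℝ → ℝ} (hR : 1 ≤ R)
    (hK : 0 ≤ K)
    (hu : ∀ x, HasDerivAt u (w x) x) (hw : Continuous w)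
    (hW : ∀ x, HasDerivAt W (W' x) x) (hW' : Continuous W')
    (hV : ∀ x, HasDerivAt V (V' x) x) (hV' : Continuous V') (hu0 : ∀ x, 0 ≤ u x)
    (huN : ∀ x ∈ Icc (-R) R, u x ≤ N)
    (he : ∀ x ∈ Icc (-R) R, |V x - u x * W' x| ≤ δ) (hP : ∀ x ∈ Icc (-R) R, |W' x| ≤ P)
    (hQ : ∀ x ∈ Icc (-R) R, ∀ y ∈ Icc (-R) R, truncSqD (W x - W y - K * |x - y|) ≤ Q) :
    ∫ y in (-R)..R, ∫ x in (-R)..R,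
        truncSqD (W x - W y - K * |x - y|) * bump R x * bump R y * V' x ≤
      K * (∫ y in (-R)..R, ∫ x in (-R)..R,
        signedD (W x - W y - K * |x - y|) (x - y) * bump R x * bump R y * w x) +
      8 / R ^ 2 * N * (∫ y in (-R)..R, ∫ x in (-R)..R, truncSq (W x - W y - K * |x - y|)) +
      (2 * R) * ((2 * R) * (δ * (2 * (P + K) + 4 * Q))) := by
  have hWc : Continuous W := continuous_iff_continuousAt.2 fun x => (hW x).continuousAt
  have huc : Continuous u := continuous_iff_continuousAt.2 fun x => (hu x).continuousAt
  have hR0 : 0 < R := by linarith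
  have hE : 0 ≤ (2 * R) * (δ * (2 * (P + K) + 4 * Q)) := by
    have h0 : (0 : ℝ) ∈ Icc (-R) R := ⟨by linarith, by linarith⟩
    have h1 := (abs_nonneg _).trans (he 0 h0)
    have h2 := (abs_nonneg _).trans (hP 0 h0)
    have h3 := (truncSqD_nonneg _).trans (hQ 0 h0 0 h0)
    positivity
  have hs : Continuous fun p : ℝ × ℝ =>
      signedD (W p.1 - W p.2 - K * |p.1 - p.2|) (p.1 - p.2) :=
    continuous_signedD (by fun_prop) (by fun_prop) fun x hx => by
      rw [sub_eq_zero.1 hx]; simp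
  have hs' : Continuous fun p : ℝ × ℝ =>
      signedD (W p.2 - W p.1 - K * |p.2 - p.1|) (p.2 - p.1) := hs.comp continuous_swap
  have hs1 : ∀ y, Continuous fun x => signedD (W x - W y - K * |x - y|) (x - y) := fun y =>
    hs.comp (f := fun x => (x, y)) (by fun_prop)
  have hm : ∫ y in (-R)..R, ∫ x in (-R)..R,
        truncSqD (W x - W y - K * |x - y|) * bump R x * bump R y * V' x ≤
      ∫ y in (-R)..R, (K * (∫ x in (-R)..R,
        signedD (W x - W y - K * |x - y|) (x - y) * bump R x * bump R y * w x) +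
      8 / R ^ 2 * N * (∫ x in (-R)..R, truncSq (W x - W y - K * |x - y|)) +
      (2 * R) * (δ * (2 * (P + K) + 4 * Q))) := by
    refine intervalIntegral.integral_mono_on (by linarith)
      (Continuous.intervalIntegrable (by fun_prop) _ _)
      (Continuous.intervalIntegrable (by fun_prop) _ _) fun y hy => ?_
    have h := energy_inequality_line (Q := Q) hR hy hK hu hw hW hW' hV hV' hu0 he hP
      (fun x hx => hQ x hx y hy)
    have h' := mul_le_mul_of_nonneg_left h (bump_nonneg R y)
    have e1 : bump R y * ∫ x in (-R)..R, truncSqD (W x - W y - K * |x - y|) * bump R x * V' x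
        = ∫ x in (-R)..R, truncSqD (W x - W y - K * |x - y|) * bump R x * bump R y * V' x := by
      rw [← intervalIntegral.integral_const_mul]
      congr 1; ext x; ring
    have e2 : bump R y * (∫ x in (-R)..R,
          signedD (W x - W y - K * |x - y|) (x - y) * bump R x * w x)
        = ∫ x in (-R)..R,
          signedD (W x - W y - K * |x - y|) (x - y) * bump R x * bump R y * w x := by
      rw [← intervalIntegral.integral_const_mul]
      congr 1; ext x; ring
    have e3 : bump R y * ∫ x in (-R)..R, u x * truncSq (W x - W y - K * |x - y|) ≤
        N * ∫ x in (-R)..R, truncSq (W x - W y - K * |x - y|) := by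
      rw [← intervalIntegral.integral_const_mul, ← intervalIntegral.integral_const_mul]
      refine intervalIntegral.integral_mono_on (by linarith)
        (Continuous.intervalIntegrable (by fun_prop) _ _)
        (Continuous.intervalIntegrable (by fun_prop) _ _) fun x hx => ?_
      rw [← mul_assoc]
      refine mul_le_mul_of_nonneg_right ?_ (truncSq_nonneg _)
      calc bump R y * u x ≤ 1 * u x := mul_le_mul_of_nonneg_right (bump_le_one hR0 hy) (hu0 x)
        _ ≤ N := by rw [one_mul]; exact huN x hx
    have e4 : bump R y * ((2 * R) * (δ * (2 * (P + K) + 4 * Q))) ≤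
        (2 * R) * (δ * (2 * (P + K) + 4 * Q)) :=
      mul_le_of_le_one_left hE (bump_le_one hR0 hy)
    have e5 := mul_le_mul_of_nonneg_left e3 (by positivity : 0 ≤ 8 / R ^ 2)
    rw [e1, mul_add, mul_add, mul_left_comm, e2] at h'
    linarith
  refine hm.trans (le_of_eq ?_)
  rw [intervalIntegral.integral_add (Continuous.intervalIntegrable (by fun_prop) _ _)
    (Continuous.intervalIntegrable (by fun_prop) _ _), intervalIntegral.integral_add
    (Continuous.intervalIntegrable (by fun_prop) _ _)
    (Continuous.intervalIntegrable (by fun_prop) _ _), intervalIntegral.integral_const_mul,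
    intervalIntegral.integral_const_mul, intervalIntegral.integral_const, smul_eq_mul]
  ring

/-- Energy inequality in two variables for the comparison function
`W x - W y - K * |x - y|`. -/
lemma energy_inequality_plane {R K δ P Q N : ℝ} {u w W W' V V' : ℝ → ℝ} (hR : 1 ≤ R)
    (hK : 0 ≤ K)
    (hu : ∀ x, HasDerivAt u (w x) x) (hw : Continuous w)
    (hW : ∀ x, HasDerivAt W (W' x) x) (hW' : Continuous W')
    (hV : ∀ x, HasDerivAt V (V' x) x) (hV' : Continuous V') (hu0 : ∀ x, 0 ≤ u x)
    (huN : ∀ x ∈ Icc (-R) R, u x ≤ N)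
    (he : ∀ x ∈ Icc (-R) R, |V x - u x * W' x| ≤ δ) (hP : ∀ x ∈ Icc (-R) R, |W' x| ≤ P)
    (hQ : ∀ x ∈ Icc (-R) R, ∀ y ∈ Icc (-R) R, truncSqD (W x - W y - K * |x - y|) ≤ Q) :
    ∫ x in (-R)..R, ∫ y in (-R)..R,
        truncSqD (W x - W y - K * |x - y|) * bump R x * bump R y * (V' x - V' y) ≤
      K * (∫ x in (-R)..R, ∫ y in (-R)..R,
        truncSqD (W x - W y - K * |x - y|) * bump R x * bump R y * |w x - w y|) +
      16 / R ^ 2 * N * (∫ x in (-R)..R, ∫ y in (-R)..R, truncSq (W x - W y - K * |x - y|)) +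
      2 * ((2 * R) * ((2 * R) * (δ * (2 * (P + K) + 4 * Q)))) := by
  have hWc : Continuous W := continuous_iff_continuousAt.2 fun x => (hW x).continuousAt
  have huc : Continuous u := continuous_iff_continuousAt.2 fun x => (hu x).continuousAt
  have h1 := energy_inequality_half hR hK hu hw hW hW' hV hV' hu0 huN he hP hQ
  have h2 := energy_inequality_half (W := fun x => -W x) (W' := fun x => -W' x)
    (V := fun x => -V x) (V' := fun x => -V' x) (δ := δ) (P := P) (Q := Q) hR hK hu hw
    (fun x => (hW x).neg) hW'.neg (fun x => (hV x).neg) hV'.neg hu0 huN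
    (fun x hx => by
      have := he x hx
      rwa [show -V x - u x * -W' x = -(V x - u x * W' x) by ring, abs_neg])
    (fun x hx => by rw [abs_neg]; exact hP x hx)
    (fun x hx y hy => by
      have := hQ y hy x hx
      rwa [show -W x - -W y - K * |x - y| = W y - W x - K * |y - x| by rw [abs_sub_comm]; ring])
  have hsw : ∀ x y, -W y - -W x - K * |y - x| = W x - W y - K * |x - y| := fun x y => by
    rw [abs_sub_comm]; ring
  simp only [hsw] at h2
  have hs : Continuous fun p : ℝ × ℝ =>
      signedD (W p.1 - W p.2 - K * |p.1 - p.2|) (p.1 - p.2) :=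
    continuous_signedD (by fun_prop) (by fun_prop) fun x hx => by
      rw [sub_eq_zero.1 hx]; simp
  have hs1 : ∀ x, Continuous fun y => signedD (W x - W y - K * |x - y|) (x - y) := fun x =>
    hs.comp (f := fun y => (x, y)) (by fun_prop)
  have hsg : ∀ x y, signedD (W x - W y - K * |x - y|) (y - x)
      = -signedD (W x - W y - K * |x - y|) (x - y) := fun x y => by
    rw [← signedD_swap _ _ fun h => by rw [sub_eq_zero.1 h]; simp, neg_sub]
  simp only [hsg] at h2
  rw [intervalIntegral_swap_of_continuous (by fun_prop),
    intervalIntegral_swap_of_continuous (F := fun y x =>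
      signedD (W x - W y - K * |x - y|) (x - y) * bump R x * bump R y * w x)
      (by
        have := hs.comp continuous_swap
        simp only [Function.comp_def, Prod.fst_swap, Prod.snd_swap] at this
        fun_prop),
    intervalIntegral_swap_of_continuous (F := fun y x => truncSq (W x - W y - K * |x - y|))
      (by fun_prop)] at h1
  have e1 : ∫ x in (-R)..R, ∫ y in (-R)..R,
        truncSqD (W x - W y - K * |x - y|) * bump R x * bump R y * (V' x - V' y)
      = (∫ x in (-R)..R, ∫ y in (-R)..R,
        truncSqD (W x - W y - K * |x - y|) * bump R x * bump R y * V' x) +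
        ∫ x in (-R)..R, ∫ y in (-R)..R,
        truncSqD (W x - W y - K * |x - y|) * bump R y * bump R x * -V' y := by
    rw [← intervalIntegral.integral_add (Continuous.intervalIntegrable (by fun_prop) _ _)
      (Continuous.intervalIntegrable (by fun_prop) _ _)]
    congr 1; ext x
    rw [← intervalIntegral.integral_add (Continuous.intervalIntegrable (by fun_prop) _ _)
      (Continuous.intervalIntegrable (by fun_prop) _ _)]
    congr 1; ext y; ring
  have e2 : (∫ x in (-R)..R, ∫ y in (-R)..R,
        signedD (W x - W y - K * |x - y|) (x - y) * bump R x * bump R y * w x) +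
      (∫ x in (-R)..R, ∫ y in (-R)..R,
        -signedD (W x - W y - K * |x - y|) (x - y) * bump R y * bump R x * w y)
      ≤ ∫ x in (-R)..R, ∫ y in (-R)..R,
        truncSqD (W x - W y - K * |x - y|) * bump R x * bump R y * |w x - w y| := by
    rw [← intervalIntegral.integral_add (Continuous.intervalIntegrable (by fun_prop) _ _)
      (Continuous.intervalIntegrable (by fun_prop) _ _)]
    have : ∀ x, (∫ y in (-R)..R,
        signedD (W x - W y - K * |x - y|) (x - y) * bump R x * bump R y * w x) +
      (∫ y in (-R)..R,
        -signedD (W x - W y - K * |x - y|) (x - y) * bump R y * bump R x * w y) =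
      ∫ y in (-R)..R,
        signedD (W x - W y - K * |x - y|) (x - y) * (w x - w y) * (bump R x * bump R y) := by
      intro x
      rw [← intervalIntegral.integral_add (Continuous.intervalIntegrable (by fun_prop) _ _)
        (Continuous.intervalIntegrable (by fun_prop) _ _)]
      congr 1; ext y; ring
    simp only [this]
    refine intervalIntegral_iterated_mono (by fun_prop) (by fun_prop) (by linarith) ?_
    intro x _ y _
    have h3 := signedD_mul_le (W x - W y - K * |x - y|) (x - y) (w x - w y)
    have h4 := mul_nonneg (bump_nonneg R x) (bump_nonneg R y)
    nlinarith
  rw [e1]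
  have e3 := mul_le_mul_of_nonneg_left e2 hK
  rw [mul_add] at e3
  have e4 : 16 / R ^ 2 = 8 / R ^ 2 + 8 / R ^ 2 := by ring
  rw [e4]
  linarith

lemma hasDerivAt_intervalIntegral_param {F F' : ℝ → ℝ → ℝ} {s : Set ℝ} (hs : IsOpen s)
    (hF : Continuous (Function.uncurry F)) (hF' : Continuous (Function.uncurry F'))
    (h : ∀ x ∈ s, ∀ z, HasDerivAt (fun x => F x z) (F' x z) x) (a b : ℝ) {x₀ : ℝ} (hx₀ : x₀ ∈ s) :
    HasDerivAt (fun x => ∫ z in a..b, F x z) (∫ z in a..b, F' x₀ z) x₀ := by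
  obtain ⟨r, hr, hrs⟩ := Metric.nhds_basis_closedBall.mem_iff.1 (hs.mem_nhds hx₀)
  obtain ⟨C, hC⟩ := ((isCompact_closedBall x₀ r).prod (isCompact_uIcc (a := a) (b := b))
    ).exists_bound_of_continuousOn hF'.continuousOn
  refine (intervalIntegral.hasDerivAt_integral_of_dominated_loc_of_deriv_le (F' := F')
    (bound := fun _ => C) (Metric.closedBall_mem_nhds x₀ hr) ?_ ?_ ?_ ?_ ?_ ?_).2
  · exact Eventually.of_forall fun x =>
      (hF.comp (f := fun z => (x, z)) (by fun_prop)).aestronglyMeasurable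
  · exact (hF.comp (f := fun z => (x₀, z)) (by fun_prop)).intervalIntegrable _ _
  · exact (hF'.comp (f := fun z => (x₀, z)) (by fun_prop)).aestronglyMeasurable
  · exact Eventually.of_forall fun z hz x hx => hC (x, z) ⟨hx, uIoc_subset_uIcc hz⟩
  · exact intervalIntegrable_const
  · exact Eventually.of_forall fun z _ x hx => h x (hrs hx) z

/-- Smooth functions supported in `(-1, 1)`. -/
structure IsTest (φ : ℝ → ℝ) : Prop where
  smooth : ContDiff ℝ (⊤ : ℕ∞) φ
  support : tsupport φ ⊆ Ioo (-1) 1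

namespace IsTest

variable {φ : ℝ → ℝ}

lemma continuous (h : IsTest φ) : Continuous φ := h.smooth.continuous

lemma deriv (h : IsTest φ) : IsTest (deriv φ) :=
  ⟨h.smooth.iterate_deriv 1, fun _ hz => h.support (tsupport_deriv_subset hz)⟩

lemma hasDerivAt (h : IsTest φ) (z : ℝ) : HasDerivAt φ (_root_.deriv φ z) z :=
  ((h.smooth.differentiable (by simp)) z).hasDerivAt

lemma eq_zero (h : IsTest φ) {z : ℝ} (hz : z ∉ Ioo (-1 : ℝ) 1) : φ z = 0 :=
  image_eq_zero_of_notMem_tsupport fun h' => hz (h.support h')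

lemma hasCompactSupport (h : IsTest φ) : HasCompactSupport φ :=
  HasCompactSupport.of_support_subset_isCompact (isCompact_Icc (a := -1) (b := 1))
    ((subset_tsupport φ).trans (h.support.trans Ioo_subset_Icc_self))

lemma support_subset (h : IsTest φ) : Function.support φ ⊆ Ioc (-1) 1 :=
  (subset_tsupport φ).trans (h.support.trans Ioo_subset_Ioc_self)

lemma integral_deriv (h : IsTest φ) : ∫ z in (-1 : ℝ)..1, _root_.deriv φ z = 0 := by
  rw [intervalIntegral.integral_eq_sub_of_hasDerivAt (fun z _ => h.hasDerivAt z)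
    (h.deriv.continuous.intervalIntegrable _ _), h.eq_zero (by simp), h.eq_zero (by simp), sub_zero]

end IsTest

lemma exists_isTest_integral_eq_one : ∃ k : ℝ → ℝ, IsTest k ∧ ∫ z in (-1 : ℝ)..1, k z = 1 := by
  let B : ContDiffBump (0 : ℝ) := ⟨1 / 4, 1 / 2, by norm_num, by norm_num⟩
  have h : IsTest (B.normed volume) := by
    refine ⟨B.contDiff_normed, ?_⟩
    rw [B.tsupport_normed_eq, Real.closedBall_eq_Icc]
    intro z hz
    simp only [B, mem_Icc, mem_Ioo] at hz ⊢
    constructor <;> linarith [hz.1, hz.2]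
  refine ⟨_, h, ?_⟩
  rw [intervalIntegral.integral_eq_integral_of_support_subset h.support_subset, B.integral_normed]

/-- Mollification of `f` at scale `ε`, with kernel `φ` supported in `[-1, 1]`. -/
def mol (φ f : ℝ → ℝ) (ε x : ℝ) : ℝ := ∫ z in (-1 : ℝ)..1, φ z * f (x - ε * z)

lemma continuous_mol_param {X : Type*} [TopologicalSpace X] [FirstCountableTopology X]
    {φ : ℝ → ℝ} {f : X → ℝ → ℝ} (hφ : Continuous φ) (hf : Continuous (Function.uncurry f))
    {ε x : X → ℝ} (hε : Continuous ε) (hx : Continuous x) :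
    Continuous fun p => mol φ (f p) (ε p) (x p) := by
  unfold mol
  refine intervalIntegral.continuous_parametric_intervalIntegral_of_continuous' ?_ _ _
  have : Continuous fun q : X × ℝ => f q.1 (x q.1 - ε q.1 * q.2) :=
    hf.comp (f := fun q : X × ℝ => (q.1, x q.1 - ε q.1 * q.2)) (by fun_prop)
  fun_prop

lemma mol_zero {k f : ℝ → ℝ} (hk : ∫ z in (-1 : ℝ)..1, k z = 1) (x : ℝ) : mol k f 0 x = f x := by
  simp [mol, hk]

lemma mol_of_hasDerivAt {φ f F : ℝ → ℝ} (hφ : IsTest φ) (hf : Continuous f)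
    (hF : ∀ x, HasDerivAt F (f x) x) {ε : ℝ} (hε : ε ≠ 0) (x : ℝ) :
    mol φ f ε x = ε⁻¹ * mol (deriv φ) F ε x := by
  have h1 : ∀ z, HasDerivAt (fun z => F (x - ε * z)) (-ε * f (x - ε * z)) z := fun z => by
    have := (hF (x - ε * z)).comp z (((hasDerivAt_id z).const_mul ε).const_sub x)
    refine this.congr_deriv ?_
    simp; ring
  have hd := hφ.deriv.continuous
  have h2 := intervalIntegral.integral_mul_deriv_eq_deriv_mul (a := -1) (b := 1)
    (fun z _ => hφ.hasDerivAt z) (fun z _ => h1 z) (hd.intervalIntegrable _ _)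
    (Continuous.intervalIntegrable (by fun_prop) _ _)
  rw [hφ.eq_zero (by simp), hφ.eq_zero (z := -1) (by simp)] at h2
  have h3 : ∫ z in (-1 : ℝ)..1, φ z * (-ε * f (x - ε * z)) = -ε * mol φ f ε x := by
    rw [mol, ← intervalIntegral.integral_const_mul]
    congr 1; ext z; ring
  rw [h3] at h2
  unfold mol at h2 ⊢
  field_simp
  linarith

lemma hasDerivAt_mol {φ f : ℝ → ℝ} (hφ : IsTest φ) (hf : Continuous f) {ε : ℝ} (hε : ε ≠ 0)
    (x : ℝ) : HasDerivAt (mol φ f ε) (ε⁻¹ * mol (deriv φ) f ε x) x := by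
  set F : ℝ → ℝ := fun x => ∫ y in (0 : ℝ)..x, f y with hFdef
  have hF : ∀ x, HasDerivAt F (f x) x := fun x =>
    intervalIntegral.integral_hasDerivAt_right (hf.intervalIntegrable _ _)
      (hf.stronglyMeasurableAtFilter _ _) hf.continuousAt
  have hFc : Continuous F := continuous_iff_continuousAt.2 fun x => (hF x).continuousAt
  have hd := hφ.deriv.continuous
  have h1 : mol φ f ε = fun x => ε⁻¹ * mol (deriv φ) F ε x :=
    funext fun x => mol_of_hasDerivAt hφ hf hF hε x
  rw [h1]
  refine HasDerivAt.const_mul _ ?_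
  refine hasDerivAt_intervalIntegral_param (F := fun x z => deriv φ z * F (x - ε * z))
    (F' := fun x z => deriv φ z * f (x - ε * z)) isOpen_univ (by fun_prop) (by fun_prop) ?_ _ _
    (mem_univ x)
  intro x _ z
  have := (hF (x - ε * z)).comp x ((hasDerivAt_id x).sub_const (ε * z))
  exact (this.const_mul (deriv φ z)).congr_deriv (by simp)

lemma integral_kernel_mul {φ f : ℝ → ℝ} (hφ : IsTest φ) {ε : ℝ} (hε : 0 < ε) (x : ℝ) :
    ∫ y, φ (ε⁻¹ * (x - y)) * f y = ε * mol φ f ε x := by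
  have h1 : mol φ f ε x = ∫ z, φ z * f (x - ε * z) := by
    refine intervalIntegral.integral_eq_integral_of_support_subset ?_
    exact (Function.support_mul_subset_left _ _).trans hφ.support_subset
  have h2 := Measure.integral_comp_mul_left
    (fun z => φ (ε⁻¹ * z) * f (x - z)) ε
  have h3 := integral_sub_left_eq_self (fun z => φ (ε⁻¹ * z) * f (x - z)) volume x
  simp only [sub_sub_cancel, ← mul_assoc, inv_mul_cancel₀ hε.ne', one_mul] at h2 h3
  rw [h1, h2, h3, abs_of_pos (inv_pos.2 hε), smul_eq_mul, ← mul_assoc, mul_inv_cancel₀ hε.ne',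
    one_mul]

lemma norm_mol_le {φ f : ℝ → ℝ} {ε x C B : ℝ} (hφ : ∀ z, |φ z| ≤ C)
    (hf : ∀ z ∈ Icc (-1 : ℝ) 1, |f (x - ε * z)| ≤ B) : |mol φ f ε x| ≤ 2 * (C * B) := by
  have h := intervalIntegral.norm_integral_le_of_norm_le_const (a := -1) (b := 1) (C := C * B)
    (f := fun z => φ z * f (x - ε * z)) fun z hz => by
      rw [uIoc_of_le (by norm_num)] at hz
      rw [Real.norm_eq_abs, abs_mul]
      exact mul_le_mul (hφ z) (hf z ⟨hz.1.le, hz.2⟩) (abs_nonneg _) ((abs_nonneg _).trans (hφ z))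
  rw [Real.norm_eq_abs] at h
  refine h.trans (le_of_eq ?_)
  norm_num
  ring

lemma norm_mol_deriv_le {k w : ℝ → ℝ} {ε x C g : ℝ} (hk : IsTest k) (hw : Continuous w)
    (hC : ∀ z, |deriv k z| ≤ C) (hε : 0 < ε) (hg : ∀ y, |w y - w x| ≤ g * |y - x|) :
    |ε⁻¹ * mol (deriv k) w ε x| ≤ 2 * (C * g) := by
  have hd := hk.deriv.continuous
  have h1 : mol (deriv k) w ε x = mol (deriv k) (fun y => w y - w x) ε x := by
    unfold mol
    simp only [mul_sub]
    rw [intervalIntegral.integral_sub (Continuous.intervalIntegrable (by fun_prop) _ _)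
      (Continuous.intervalIntegrable (by fun_prop) _ _), intervalIntegral.integral_mul_const,
      hk.integral_deriv]
    simp
  have hg0 : 0 ≤ g := by simpa using (abs_nonneg _).trans (hg (x + 1))
  have h2 := norm_mol_le (f := fun y => w y - w x) (ε := ε) (x := x) (B := g * ε) hC
    fun z hz => by
      refine (hg _).trans ?_
      gcongr
      rw [sub_sub_cancel_left, abs_neg, abs_mul, abs_of_pos hε]
      exact mul_le_of_le_one_right hε.le (abs_le.2 hz)
  rw [h1, abs_mul, abs_of_pos (inv_pos.2 hε)]
  calc _ ≤ ε⁻¹ * (2 * (C * (g * ε))) := by gcongr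
    _ = _ := by field_simp

/-- Commutator estimate: the mollified flux `(u w')_ε` (in integrated form) is close to
`u (w_ε)'`. -/
lemma commutator_le {k u w : ℝ → ℝ} {ε x C N g : ℝ} (hk : IsTest k)
    (hC : ∀ z, |k z| ≤ C) (hC' : ∀ z, |deriv k z| ≤ C) (hε : 0 < ε) (hw : Continuous w)
    (hu : ∀ x, HasDerivAt u (w x) x)
    (hN : ∀ y ∈ Icc (x - ε) (x + ε), |w y| ≤ N) (hg : ∀ y, |w y - w x| ≤ g * |y - x|) :
    |-mol k (fun y => w y ^ 2) ε x + ε⁻¹ * mol (deriv k) (fun y => w y * u y) ε x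
      - u x * (ε⁻¹ * mol (deriv k) w ε x)| ≤ 4 * (C * N * g * ε) := by
  have hd := hk.deriv.continuous
  have hkc := hk.continuous
  have huc : Continuous u := continuous_iff_continuousAt.2 fun x => (hu x).continuousAt
  set G : ℝ → ℝ := fun z => (u (x - ε * z) - u x) * k z with hG
  set G' : ℝ → ℝ := fun z => -ε * w (x - ε * z) * k z + (u (x - ε * z) - u x) * deriv k z with hG'
  have hGd : ∀ z, HasDerivAt G (G' z) z := fun z => by
    have := (hu (x - ε * z)).comp z (((hasDerivAt_id z).const_mul ε).const_sub x)
    refine ((this.sub_const (u x)).mul (hk.hasDerivAt z)).congr_deriv ?_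
    simp only [hG', Function.comp_apply, id_eq]; ring
  have hGc : Continuous G' := by fun_prop
  have hGi : ∫ z in (-1 : ℝ)..1, G' z = 0 := by
    rw [intervalIntegral.integral_eq_sub_of_hasDerivAt (fun z _ => hGd z)
      (hGc.intervalIntegrable _ _)]
    simp only [hG]
    rw [hk.eq_zero (by simp), hk.eq_zero (by simp)]; ring
  have e1 : -mol k (fun y => w y ^ 2) ε x + ε⁻¹ * mol (deriv k) (fun y => w y * u y) ε x
      - u x * (ε⁻¹ * mol (deriv k) w ε x) =
      ε⁻¹ * ∫ z in (-1 : ℝ)..1, (w (x - ε * z) - w x) * G' z := by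
    have : ∫ z in (-1 : ℝ)..1, (w (x - ε * z) - w x) * G' z
        = ∫ z in (-1 : ℝ)..1, w (x - ε * z) * G' z := by
      simp only [sub_mul]
      rw [intervalIntegral.integral_sub (Continuous.intervalIntegrable (by fun_prop) _ _)
        (Continuous.intervalIntegrable (by fun_prop) _ _), intervalIntegral.integral_const_mul,
        hGi]
      simp
    rw [this]
    unfold mol
    rw [← intervalIntegral.integral_neg, ← intervalIntegral.integral_const_mul,
      ← intervalIntegral.integral_const_mul, ← intervalIntegral.integral_const_mul,
      ← intervalIntegral.integral_const_mul,
      ← intervalIntegral.integral_add (Continuous.intervalIntegrable (by fun_prop) _ _)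
        (Continuous.intervalIntegrable (by fun_prop) _ _),
      ← intervalIntegral.integral_sub (Continuous.intervalIntegrable (by fun_prop) _ _)
        (Continuous.intervalIntegrable (by fun_prop) _ _)]
    congr 1; ext z
    simp only [hG']
    field_simp
    ring
  have hg0 : 0 ≤ g := by simpa using (abs_nonneg _).trans (hg (x + 1))
  have hN0 : 0 ≤ N := (abs_nonneg _).trans (hN x ⟨by linarith, by linarith⟩)
  have hC0 : 0 ≤ C := (abs_nonneg _).trans (hC 0)
  have e2 : ∀ z ∈ Icc (-1 : ℝ) 1, |(w (x - ε * z) - w x) * G' z| ≤ g * ε * (2 * (ε * N * C)) := by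
    intro z hz
    have hεz : |ε * z| ≤ ε := by
      rw [abs_mul, abs_of_pos hε]
      exact mul_le_of_le_one_right hε.le (abs_le.2 hz)
    have hmem : x - ε * z ∈ Icc (x - ε) (x + ε) := by
      have := abs_le.1 hεz
      constructor <;> linarith [this.1, this.2]
    have a1 : |w (x - ε * z) - w x| ≤ g * ε := by
      refine (hg _).trans ?_
      gcongr
      rwa [sub_sub_cancel_left, abs_neg]
    have a2 : |u (x - ε * z) - u x| ≤ N * ε := by
      have := (convex_Icc (x - ε) (x + ε)).norm_image_sub_le_of_norm_hasDerivWithin_le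
        (fun y _ => (hu y).hasDerivWithinAt) hN
        (show x ∈ Icc (x - ε) (x + ε) from ⟨by linarith, by linarith⟩) hmem
      refine this.trans ?_
      gcongr
      rwa [sub_sub_cancel_left, norm_neg]
    have a3 : |G' z| ≤ 2 * (ε * N * C) := by
      refine (abs_add_le _ _).trans ?_
      rw [abs_mul, abs_mul, abs_mul, abs_neg, abs_of_pos hε]
      have b1 : ε * |w (x - ε * z)| * |k z| ≤ ε * N * C := by
        gcongr
        · exact hN _ hmem
        · exact hC z
      have b2 : |u (x - ε * z) - u x| * |deriv k z| ≤ N * ε * C := by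
        gcongr
        exact hC' z
      linarith
    rw [abs_mul]
    gcongr
  have e3 := intervalIntegral.norm_integral_le_of_norm_le_const (a := -1) (b := 1)
    (C := g * ε * (2 * (ε * N * C)))
    (f := fun z => (w (x - ε * z) - w x) * G' z) fun z hz => by
      rw [uIoc_of_le (by norm_num)] at hz
      exact e2 z ⟨hz.1.le, hz.2⟩
  rw [e1, abs_mul, abs_of_pos (inv_pos.2 hε)]
  rw [Real.norm_eq_abs] at e3
  norm_num at e3
  calc _ ≤ ε⁻¹ * (g * ε * (2 * (ε * N * C)) * 2) := by gcongr
    _ = _ := by field_simp; ring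

/-- A nonnegative function `u` of quadratic growth with continuous space derivative `w`,
satisfying the equation on `[a, b]` when tested against functions of `x` alone, and such that
`w t` is `g t`-Lipschitz for almost every `t`. -/
structure IsFlow (a b M : ℝ) (g : ℝ → ℝ) (u w : ℝ → ℝ → ℝ) : Prop where
  continuous_left : Continuous (Function.uncurry u)
  continuous_deriv : Continuous (Function.uncurry w)
  hasDerivAt : ∀ t x, HasDerivAt (u t) (w t x) x
  nonneg : ∀ t x, 0 ≤ u t x
  le_quad : ∀ t x, u t x ≤ M * (x ^ 2 + 1)
  integrable : IntervalIntegrable g volume a b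
  one_le : ∀ t, 1 ≤ g t
  lipschitz : ∀ᵐ t, t ∈ Ioc a b → ∀ x y, |w t x - w t y| ≤ g t * |x - y|
  weak : ∀ φ : ℝ → ℝ, ContDiff ℝ (⊤ : ℕ∞) φ → HasCompactSupport φ →
    ∀ s t, a ≤ s → s ≤ t → t ≤ b → (∫ x, u t x * φ x) - ∫ x, u s x * φ x =
      ∫ r in s..t, ∫ x, -(1 / 2) * ((deriv φ x * u r x + φ x * w r x) * w r x)

/-- The flux `u w'` mollified at scale `ε`, where `w = u'`, written without derivatives of `w`. -/
def molFlux (k u w : ℝ → ℝ) (ε x : ℝ) : ℝ :=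
  -mol k (fun y => w y ^ 2) ε x + ε⁻¹ * mol (deriv k) (fun y => w y * u y) ε x

/-- The derivative of `molFlux k u w ε`. -/
def molFluxD (k u w : ℝ → ℝ) (ε x : ℝ) : ℝ :=
  ε⁻¹ * molFlux (deriv k) u w ε x

lemma hasDerivAt_molFlux {k u w : ℝ → ℝ} (hk : IsTest k) (hu : Continuous u) (hw : Continuous w)
    {ε : ℝ} (hε : ε ≠ 0) (x : ℝ) : HasDerivAt (molFlux k u w ε) (molFluxD k u w ε x) x := by
  have h1 := hasDerivAt_mol hk (f := fun y => w y ^ 2) (by fun_prop) hε x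
  have h2 := hasDerivAt_mol hk.deriv (f := fun y => w y * u y) (by fun_prop) hε x
  refine (h1.neg.add (h2.const_mul ε⁻¹)).congr_deriv ?_
  unfold molFluxD molFlux
  ring

lemma continuous_molFluxD_param {X : Type*} [TopologicalSpace X] [FirstCountableTopology X]
    {k : ℝ → ℝ} {u w : X → ℝ → ℝ} (hk : IsTest k) (hu : Continuous (Function.uncurry u))
    (hw : Continuous (Function.uncurry w)) (ε : ℝ) {x : X → ℝ} (hx : Continuous x) :
    Continuous fun p => molFluxD k (u p) (w p) ε (x p) := by
  unfold molFluxD molFlux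
  have h1 := continuous_mol_param hk.deriv.continuous (f := fun p y => w p y ^ 2)
    (by exact hw.pow 2) (continuous_const (y := ε)) hx
  have h2 := continuous_mol_param hk.deriv.deriv.continuous (f := fun p y => w p y * u p y)
    (by exact hw.mul hu) (continuous_const (y := ε)) hx
  fun_prop

namespace IsFlow

variable {a b M : ℝ} {g : ℝ → ℝ} {u w : ℝ → ℝ → ℝ}

lemma continuous_apply (h : IsFlow a b M g u w) (t : ℝ) : Continuous (u t) :=
  h.continuous_left.comp (f := fun x => (t, x)) (by fun_prop)

lemma continuous_deriv_apply (h : IsFlow a b M g u w) (t : ℝ) : Continuous (w t) :=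
  h.continuous_deriv.comp (f := fun x => (t, x)) (by fun_prop)

lemma mol_sub_mol (h : IsFlow a b M g u w) {k : ℝ → ℝ} (hk : IsTest k) {ε : ℝ} (hε : 0 < ε)
    (x : ℝ) {s t : ℝ} (hs : a ≤ s) (hst : s ≤ t) (ht : t ≤ b) :
    mol k (w t) ε x - mol k (w s) ε x = ∫ r in s..t, 1 / 2 * molFluxD k (u r) (w r) ε x := by
  set φ : ℝ → ℝ := fun y => deriv k (ε⁻¹ * (x - y)) with hφ
  have hφs : ContDiff ℝ (⊤ : ℕ∞) φ := hk.deriv.smooth.comp (by fun_prop)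
  have hφz : ∀ y, y ∉ Icc (x - ε) (x + ε) → φ y = 0 := by
    intro y hy
    refine hk.deriv.eq_zero fun h => hy ?_
    have h1 := h.1
    have h2 := h.2
    rw [inv_mul_eq_div, lt_div_iff₀ hε] at h1
    rw [inv_mul_eq_div, div_lt_iff₀ hε] at h2
    constructor <;> linarith
  have hφc : HasCompactSupport φ := HasCompactSupport.intro isCompact_Icc hφz
  have hφd : ∀ y, deriv φ y = -ε⁻¹ * deriv (deriv k) (ε⁻¹ * (x - y)) := by
    intro y
    have h1 := (hk.deriv.hasDerivAt (ε⁻¹ * (x - y))).comp y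
      (((hasDerivAt_id y).const_sub x).const_mul ε⁻¹)
    refine (h1.congr_deriv ?_).deriv
    ring
  have e1 : ∀ r, ∫ y, u r y * φ y = ε ^ 2 * mol k (w r) ε x := by
    intro r
    rw [mol_of_hasDerivAt hk (h.continuous_deriv_apply r) (h.hasDerivAt r) hε.ne' x]
    have := integral_kernel_mul (f := u r) hk.deriv hε x
    simp only [mul_comm (u r _), hφ]
    rw [this]
    field_simp
  have e2 : ∀ r, ∫ y, -(1 / 2) * ((deriv φ y * u r y + φ y * w r y) * w r y) =
      ε ^ 2 * (1 / 2 * molFluxD k (u r) (w r) ε x) := by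
    intro r
    have hu := h.continuous_apply r
    have hw := h.continuous_deriv_apply r
    have hd := hk.deriv.continuous
    have hdd := hk.deriv.deriv.continuous
    have h1 := integral_kernel_mul (f := fun y => w r y * u r y) hk.deriv.deriv hε x
    have h2 := integral_kernel_mul (f := fun y => w r y ^ 2) hk.deriv hε x
    have i1 : Integrable fun y => deriv (deriv k) (ε⁻¹ * (x - y)) * (w r y * u r y) := by
      refine Continuous.integrable_of_hasCompactSupport (by fun_prop) ?_
      refine HasCompactSupport.mul_right (HasCompactSupport.intro (isCompact_Icc (a := x - ε)
        (b := x + ε)) fun y hy => ?_)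
      refine hk.deriv.deriv.eq_zero fun h => hy ?_
      have h1 := h.1
      have h2 := h.2
      rw [inv_mul_eq_div, lt_div_iff₀ hε] at h1
      rw [inv_mul_eq_div, div_lt_iff₀ hε] at h2
      constructor <;> linarith
    have i2 : Integrable fun y => deriv k (ε⁻¹ * (x - y)) * w r y ^ 2 :=
      Continuous.integrable_of_hasCompactSupport (by fun_prop) hφc.mul_right
    calc ∫ y, -(1 / 2) * ((deriv φ y * u r y + φ y * w r y) * w r y)
        = ∫ y, (ε⁻¹ / 2 * (deriv (deriv k) (ε⁻¹ * (x - y)) * (w r y * u r y))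
          - 1 / 2 * (deriv k (ε⁻¹ * (x - y)) * w r y ^ 2)) := by
          congr 1; ext y; rw [hφd, hφ]; ring
      _ = _ := by
        rw [integral_sub (i1.const_mul _) (i2.const_mul _), integral_const_mul,
          integral_const_mul, h1, h2]
        unfold molFluxD molFlux
        field_simp
        ring
  have h1 := h.weak φ hφs hφc s t hs hst ht
  simp only [e1, e2] at h1
  rw [intervalIntegral.integral_const_mul, ← mul_sub] at h1
  exact mul_left_cancel₀ (by positivity) h1

lemma hasDerivAt_mol_time (h : IsFlow a b M g u w) {k : ℝ → ℝ} (hk : IsTest k) {ε : ℝ}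
    (hε : 0 < ε) (x : ℝ) {t : ℝ} (ht : t ∈ Ioo a b) :
    HasDerivAt (fun t => mol k (w t) ε x) (1 / 2 * molFluxD k (u t) (w t) ε x) t := by
  have hc : Continuous fun r => 1 / 2 * molFluxD k (u r) (w r) ε x :=
    continuous_const.mul (continuous_molFluxD_param hk h.continuous_left h.continuous_deriv ε
      continuous_const)
  have h1 := intervalIntegral.integral_hasDerivAt_right (hc.intervalIntegrable a t)
    (hc.stronglyMeasurableAtFilter _ _) hc.continuousAt
  refine (h1.const_add (mol k (w a) ε x)).congr_of_eventuallyEq ?_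
  filter_upwards [Ioo_mem_nhds ht.1 ht.2] with s hs
  rw [← h.mol_sub_mol hk hε x le_rfl hs.1.le hs.2.le]
  ring

end IsFlow

/-- The amount by which the mollified `w t` violates being `K t`-Lipschitz between `x` and `y`. -/
def molGap (k : ℝ → ℝ) (w : ℝ → ℝ → ℝ) (K : ℝ → ℝ) (ε t x y : ℝ) : ℝ :=
  mol k (w t) ε x - mol k (w t) ε y - K t * |x - y|

lemma continuous_molGap {k : ℝ → ℝ} {w : ℝ → ℝ → ℝ} {K : ℝ → ℝ} (hk : Continuous k)
    (hw : Continuous (Function.uncurry w)) (hK : Continuous K) :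
    Continuous fun p : ((ℝ × ℝ) × ℝ) × ℝ => molGap k w K p.1.1.1 p.1.1.2 p.1.2 p.2 := by
  unfold molGap
  have hw' : Continuous (Function.uncurry fun p : ((ℝ × ℝ) × ℝ) × ℝ => w p.1.1.2) :=
    hw.comp (f := fun q : (((ℝ × ℝ) × ℝ) × ℝ) × ℝ => (q.1.1.1.2, q.2)) (by fun_prop)
  have h1 := continuous_mol_param hk hw' (ε := fun p => p.1.1.1) (x := fun p => p.1.2)
    (by fun_prop) (by fun_prop)
  have h2 := continuous_mol_param hk hw' (ε := fun p => p.1.1.1) (x := fun p => p.2)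
    (by fun_prop) (by fun_prop)
  fun_prop

/-- The localized energy of the excess of `w` over being `K`-Lipschitz. -/
def molEnergy (k : ℝ → ℝ) (w : ℝ → ℝ → ℝ) (K : ℝ → ℝ) (R ε t : ℝ) : ℝ :=
  ∫ x in (-R)..R, ∫ y in (-R)..R, truncSq (molGap k w K ε t x y) * bump R x * bump R y

lemma continuous_iterated_integral {X : Type*} [TopologicalSpace X] [FirstCountableTopology X]
    {F : X → ℝ → ℝ → ℝ} (hF : Continuous fun p : (X × ℝ) × ℝ => F p.1.1 p.1.2 p.2)
    (a b c d : ℝ) : Continuous fun p => ∫ x in a..b, ∫ y in c..d, F p x y := by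
  refine intervalIntegral.continuous_parametric_intervalIntegral_of_continuous' ?_ _ _
  exact intervalIntegral.continuous_parametric_intervalIntegral_of_continuous'
    (f := fun (p : X × ℝ) y => F p.1 p.2 y) hF _ _

lemma continuous_molEnergy {k : ℝ → ℝ} {w : ℝ → ℝ → ℝ} {K : ℝ → ℝ} (hk : Continuous k)
    (hw : Continuous (Function.uncurry w)) (hK : Continuous K) (R : ℝ) :
    Continuous fun p : ℝ × ℝ => molEnergy k w K R p.1 p.2 := by
  have := continuous_molGap hk hw hK
  exact continuous_iterated_integral (by fun_prop) _ _ _ _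

lemma IsFlow.hasDerivAt_molEnergy {a b M : ℝ} {g : ℝ → ℝ} {u w : ℝ → ℝ → ℝ}
    (h : IsFlow a b M g u w) {k : ℝ → ℝ} (hk : IsTest k) {K : ℝ → ℝ} (hK : Continuous K)
    (hK' : ∀ t ∈ Ioo a b, HasDerivAt K (K t ^ 2 / 2) t) (R : ℝ) {ε : ℝ} (hε : 0 < ε) {t : ℝ}
    (ht : t ∈ Ioo a b) :
    HasDerivAt (molEnergy k w K R ε) (∫ x in (-R)..R, ∫ y in (-R)..R,
      truncSqD (molGap k w K ε t x y) * bump R x * bump R y *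
        (1 / 2 * molFluxD k (u t) (w t) ε x - 1 / 2 * molFluxD k (u t) (w t) ε y
          - K t ^ 2 / 2 * |x - y|)) t := by
  have hG := continuous_molGap hk.continuous h.continuous_deriv hK
  have hG' : Continuous fun p : (ℝ × ℝ) × ℝ => molGap k w K ε p.1.1 p.1.2 p.2 :=
    hG.comp (f := fun p : (ℝ × ℝ) × ℝ => (((ε, p.1.1), p.1.2), p.2)) (by fun_prop)
  have hu' : Continuous (Function.uncurry fun p : (ℝ × ℝ) × ℝ => u p.1.1) :=
    h.continuous_left.comp (f := fun q : ((ℝ × ℝ) × ℝ) × ℝ => (q.1.1.1, q.2)) (by fun_prop)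
  have hw' : Continuous (Function.uncurry fun p : (ℝ × ℝ) × ℝ => w p.1.1) :=
    h.continuous_deriv.comp (f := fun q : ((ℝ × ℝ) × ℝ) × ℝ => (q.1.1.1, q.2)) (by fun_prop)
  have h1 := continuous_molFluxD_param hk hu' hw' ε (x := fun p => p.1.2) (by fun_prop)
  have h2 := continuous_molFluxD_param hk hu' hw' ε (x := fun p => p.2) (by fun_prop)
  set F : ℝ → ℝ → ℝ → ℝ := fun t x y => truncSq (molGap k w K ε t x y) * bump R x * bump R y
    with hF
  set F' : ℝ → ℝ → ℝ → ℝ := fun t x y => truncSqD (molGap k w K ε t x y) * bump R x * bump R y *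
        (1 / 2 * molFluxD k (u t) (w t) ε x - 1 / 2 * molFluxD k (u t) (w t) ε y
          - K t ^ 2 / 2 * |x - y|) with hF'
  have cF : Continuous fun p : (ℝ × ℝ) × ℝ => F p.1.1 p.1.2 p.2 := by simp only [hF]; fun_prop
  have cF' : Continuous fun p : (ℝ × ℝ) × ℝ => F' p.1.1 p.1.2 p.2 := by simp only [hF']; fun_prop
  have d1 : ∀ t ∈ Ioo a b, ∀ x y, HasDerivAt (fun t => F t x y) (F' t x y) t := by
    intro t ht x y
    have e1 : HasDerivAt (fun t => molGap k w K ε t x y) (1 / 2 * molFluxD k (u t) (w t) ε x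
        - 1 / 2 * molFluxD k (u t) (w t) ε y - K t ^ 2 / 2 * |x - y|) t :=
      ((h.hasDerivAt_mol_time hk hε x ht).sub (h.hasDerivAt_mol_time hk hε y ht)).sub
        ((hK' t ht).mul_const _)
    have e2 := (((hasDerivAt_truncSq _).comp t e1).mul_const (bump R x)).mul_const (bump R y)
    refine e2.congr_deriv ?_
    simp only [hF']
    ring
  have d2 : ∀ t ∈ Ioo a b, ∀ x, HasDerivAt (fun t => ∫ y in (-R)..R, F t x y)
      (∫ y in (-R)..R, F' t x y) t := fun t ht x =>
    hasDerivAt_intervalIntegral_param isOpen_Ioo (F := fun t y => F t x y)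
      (F' := fun t y => F' t x y)
      (cF.comp (f := fun p : ℝ × ℝ => ((p.1, x), p.2)) (by fun_prop))
      (cF'.comp (f := fun p : ℝ × ℝ => ((p.1, x), p.2)) (by fun_prop))
      (fun t ht y => d1 t ht x y) _ _ ht
  exact hasDerivAt_intervalIntegral_param isOpen_Ioo
      (F := fun t x => ∫ y in (-R)..R, F t x y) (F' := fun t x => ∫ y in (-R)..R, F' t x y)
      (intervalIntegral.continuous_parametric_intervalIntegral_of_continuous'
        (f := fun (p : ℝ × ℝ) y => F p.1 p.2 y) cF _ _)
      (intervalIntegral.continuous_parametric_intervalIntegral_of_continuous'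
        (f := fun (p : ℝ × ℝ) y => F' p.1 p.2 y) cF' _ _) d2 _ _ ht

lemma tendsto_integral_mul_min {g : ℝ → ℝ} {a b : ℝ} (hg : IntervalIntegrable g volume a b)
    (h1 : ∀ t, 1 ≤ g t) :
    Tendsto (fun ε : ℝ => ∫ t in a..b, g t * min (ε * g t) 1) (nhdsWithin 0 (Ioi 0)) (nhds 0) := by
  have h2 : Tendsto (fun ε : ℝ => ∫ t in a..b, g t * min (ε * g t) 1) (nhdsWithin 0 (Ioi 0))
      (nhds (∫ _ in a..b, (0 : ℝ))) := by
    refine intervalIntegral.tendsto_integral_filter_of_dominated_convergence g ?_ ?_ hg ?_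
    · refine Eventually.of_forall fun ε => ?_
      have hm := hg.def'.aestronglyMeasurable
      exact hm.mul ((hm.const_mul ε).inf aestronglyMeasurable_const)
    · filter_upwards [self_mem_nhdsWithin] with ε (hε : 0 < ε)
      refine Eventually.of_forall fun t _ => ?_
      have := h1 t
      have h0 : 0 ≤ min (ε * g t) 1 := le_min (by positivity) zero_le_one
      rw [Real.norm_eq_abs, abs_of_nonneg (by positivity)]
      exact mul_le_of_le_one_right (by positivity) (min_le_right _ _)
    · refine Eventually.of_forall fun t _ => ?_
      have : Tendsto (fun ε : ℝ => g t * min (ε * g t) 1) (nhds 0)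
          (nhds (g t * min (0 * g t) 1)) := Continuous.tendsto (by fun_prop) 0
      simp only [zero_mul, zero_le_one, min_eq_left, mul_zero] at this
      exact this.mono_left nhdsWithin_le_nhds
  simpa using h2

lemma sub_le_integral_of_perturbation {a t c : ℝ} {g : ℝ → ℝ} {E E' H : ℝ → ℝ → ℝ} (hat : a ≤ t)
    (hg : IntervalIntegrable g volume a t) (h1 : ∀ t, 1 ≤ g t)
    (hE : Continuous (Function.uncurry E)) (hH : Continuous (Function.uncurry H))
    (hE' : ∀ ε ∈ Ioc (0 : ℝ) 1, ∀ r ∈ Ioo a t, HasDerivAt (E ε) (E' ε r) r)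
    (hle : ∀ ε ∈ Ioc (0 : ℝ) 1, ∀ᵐ r, r ∈ Ioo a t →
      E' ε r ≤ H ε r + c * (g r * min (ε * g r) 1)) :
    E 0 t - E 0 a ≤ ∫ r in a..t, H 0 r := by
  have hHi : ∀ ε, IntervalIntegrable (H ε) volume a t := fun ε =>
    (hH.comp (f := fun r => (ε, r)) (by fun_prop)).intervalIntegrable _ _
  have key : ∀ ε ∈ Ioc (0 : ℝ) 1, E ε t - E ε a ≤
      (∫ r in a..t, H ε r) + c * ∫ r in a..t, g r * min (ε * g r) 1 := by
    intro ε hε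
    have hmi : IntervalIntegrable (fun r => g r * min (ε * g r) 1) volume a t := by
      refine hg.mono_fun ?_ ?_
      · have hm := hg.def'.aestronglyMeasurable
        exact hm.mul ((hm.const_mul ε).inf aestronglyMeasurable_const)
      · refine Eventually.of_forall fun t => ?_
        have := h1 t
        have := hε.1
        have h0 : 0 ≤ min (ε * g t) 1 := le_min (by positivity) zero_le_one
        simp only [Real.norm_eq_abs]
        rw [abs_of_nonneg (by positivity), abs_of_nonneg (by positivity)]
        exact mul_le_of_le_one_right (by positivity) (min_le_right _ _)
    have hB := (hHi ε).add (hmi.const_mul c)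
    set B : ℝ → ℝ := fun r => H ε r + c * (g r * min (ε * g r) 1) with hBdef
    have hae : B =ᵐ[volume.restrict (Ioo a t)] fun r => max (B r) (E' ε r) := by
      rw [EventuallyEq, ae_restrict_iff' measurableSet_Ioo]
      filter_upwards [hle ε hε] with r hr hmem
      rw [max_eq_left (hr hmem)]
    have hBi : IntegrableOn (fun r => max (B r) (E' ε r)) (Icc a t) := by
      rw [integrableOn_Icc_iff_integrableOn_Ioo]
      have := (intervalIntegrable_iff_integrableOn_Ioo_of_le hat).1 hB
      exact Integrable.congr this hae
    have h2 := intervalIntegral.sub_le_integral_of_hasDeriv_right_of_le hat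
      ((hE.comp (f := fun r => (ε, r)) (by fun_prop)).continuousOn)
      (fun r hr => (hE' ε hε r hr).hasDerivWithinAt) hBi (fun r _ => le_max_right _ _)
    refine h2.trans (le_of_eq ?_)
    rw [← intervalIntegral.integral_const_mul,
      ← intervalIntegral.integral_add (hHi ε) (hmi.const_mul c),
      intervalIntegral.integral_of_le hat, intervalIntegral.integral_of_le hat,
      integral_Ioc_eq_integral_Ioo, integral_Ioc_eq_integral_Ioo]
    exact (integral_congr_ae hae).symm
  have t1 : Tendsto (fun ε => E ε t - E ε a) (nhdsWithin 0 (Ioi 0)) (nhds (E 0 t - E 0 a)) := by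
    have : Continuous fun ε => E ε t - E ε a :=
      (hE.comp (f := fun ε => (ε, t)) (by fun_prop)).sub
        (hE.comp (f := fun ε => (ε, a)) (by fun_prop))
    exact (this.tendsto 0).mono_left nhdsWithin_le_nhds
  have t2 : Tendsto (fun ε => ∫ r in a..t, H ε r) (nhdsWithin 0 (Ioi 0))
      (nhds (∫ r in a..t, H 0 r)) :=
    ((intervalIntegral.continuous_parametric_intervalIntegral_of_continuous' hH a t).tendsto
      0).mono_left nhdsWithin_le_nhds
  have t3 := t2.add ((tendsto_integral_mul_min hg h1).const_mul c)
  rw [mul_zero, add_zero] at t3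
  refine le_of_tendsto_of_tendsto t1 t3 ?_
  filter_upwards [Ioc_mem_nhdsGT (zero_lt_one' ℝ)] with ε hε using key ε hε

/-- The right-hand side of the energy inequality at scale `ε`. -/
def molForcing (k : ℝ → ℝ) (w : ℝ → ℝ → ℝ) (K : ℝ → ℝ) (R N ε t : ℝ) : ℝ :=
  (∫ x in (-R)..R, ∫ y in (-R)..R, truncSqD (molGap k w K ε t x y) * bump R x * bump R y *
    (K t / 2 * |w t x - w t y| - K t ^ 2 / 2 * |x - y|)) +
  8 / R ^ 2 * N * ∫ x in (-R)..R, ∫ y in (-R)..R, truncSq (molGap k w K ε t x y)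

lemma continuous_molForcing {k : ℝ → ℝ} {w : ℝ → ℝ → ℝ} {K : ℝ → ℝ} (hk : Continuous k)
    (hw : Continuous (Function.uncurry w)) (hK : Continuous K) (R N : ℝ) :
    Continuous fun p : ℝ × ℝ => molForcing k w K R N p.1 p.2 := by
  have h1 := continuous_molGap hk hw hK
  have h2 : Continuous fun p : ((ℝ × ℝ) × ℝ) × ℝ => w p.1.1.2 p.1.2 :=
    hw.comp (f := fun p : ((ℝ × ℝ) × ℝ) × ℝ => (p.1.1.2, p.1.2)) (by fun_prop)
  have h3 : Continuous fun p : ((ℝ × ℝ) × ℝ) × ℝ => w p.1.1.2 p.2 :=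
    hw.comp (f := fun p : ((ℝ × ℝ) × ℝ) × ℝ => (p.1.1.2, p.2)) (by fun_prop)
  refine (continuous_iterated_integral (by fun_prop) _ _ _ _).add
    (continuous_const.mul (continuous_iterated_integral (by fun_prop) _ _ _ _))

lemma IsFlow.molEnergy_deriv_le {a b M : ℝ} {g : ℝ → ℝ} {u w : ℝ → ℝ → ℝ}
    (h : IsFlow a b M g u w) {k : ℝ → ℝ} (hk : IsTest k) {K : ℝ → ℝ} {R C S Q N κ ε t : ℝ}
    (hR : 1 ≤ R) (hC : ∀ z, |k z| ≤ C) (hC' : ∀ z, |deriv k z| ≤ C)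
    (hS : ∀ y ∈ Icc (-(R + 1)) (R + 1), |w t y| ≤ S) (hN : ∀ x ∈ Icc (-R) R, u t x ≤ N)
    (hK0 : 0 ≤ K t) (hKκ : K t ≤ κ) (hε : ε ∈ Ioc (0 : ℝ) 1)
    (hg : ∀ x y, |w t x - w t y| ≤ g t * |x - y|)
    (hQ : ∀ x ∈ Icc (-R) R, ∀ y ∈ Icc (-R) R, truncSqD (molGap k w K ε t x y) ≤ Q) :
    (∫ x in (-R)..R, ∫ y in (-R)..R,
      truncSqD (molGap k w K ε t x y) * bump R x * bump R y *
        (1 / 2 * molFluxD k (u t) (w t) ε x - 1 / 2 * molFluxD k (u t) (w t) ε y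
          - K t ^ 2 / 2 * |x - y|)) ≤
      molForcing k w K R N ε t +
        (2 * R) ^ 2 * (4 * (C * S) * (4 * C * (1 + S) + 2 * κ + 4 * Q)) *
          (g t * min (ε * g t) 1) := by
  obtain ⟨hε0, hε1⟩ := hε
  have hw := h.continuous_deriv_apply t
  have huc := h.continuous_apply t
  have hd := hk.deriv.continuous
  have hkc := hk.continuous
  have hdd := hk.deriv.deriv.continuous
  have hg1 := h.one_le t
  have hC0 : 0 ≤ C := (abs_nonneg _).trans (hC 0)
  have hS0 : 0 ≤ S := (abs_nonneg _).trans (hS 0 ⟨by linarith, by linarith⟩)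
  have hQ0 : 0 ≤ Q := (truncSqD_nonneg _).trans
    (hQ 0 ⟨by linarith, by linarith⟩ 0 ⟨by linarith, by linarith⟩)
  set m := min (ε * g t) 1 with hm
  have hm0 : 0 ≤ m := le_min (by positivity) zero_le_one
  have hεm : ε ≤ m := le_min (le_mul_of_one_le_right hε0.le hg1) hε1
  have hSx : ∀ x ∈ Icc (-R) R, ∀ y ∈ Icc (x - ε) (x + ε), |w t y| ≤ S := fun x hx y hy =>
    hS y ⟨by linarith [hx.1, hy.1], by linarith [hx.2, hy.2]⟩
  set P := ε⁻¹ * (2 * (C * (1 + S) * m)) with hP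
  have hPle : ∀ x ∈ Icc (-R) R, |ε⁻¹ * mol (deriv k) (w t) ε x| ≤ P := by
    intro x hx
    rcases le_total (ε * g t) 1 with h1 | h1
    · refine (norm_mol_deriv_le hk hw hC' hε0 fun y => hg y x).trans ?_
      rw [hP, hm, min_eq_left h1]
      have : ε⁻¹ * (2 * (C * (1 + S) * (ε * g t))) = 2 * (C * g t) + 2 * (C * S * g t) := by
        field_simp
      rw [this]
      have : 0 ≤ 2 * (C * S * g t) := by positivity
      linarith
    · rw [hP, hm, min_eq_right h1, abs_mul, abs_of_pos (inv_pos.2 hε0)]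
      gcongr
      refine (norm_mol_le (B := S) hC' fun z hz => hSx x hx _ ?_).trans ?_
      · constructor <;> nlinarith [hz.1, hz.2]
      · nlinarith
  have hmolc : ∀ {φ f : ℝ → ℝ}, Continuous φ → Continuous f → Continuous (mol φ f ε) :=
    fun {φ f} hφ hf => continuous_mol_param (f := fun _ : ℝ => f) hφ
      (hf.comp continuous_snd) continuous_const continuous_id
  have hFD : Continuous (molFluxD k (u t) (w t) ε) :=
    continuous_molFluxD_param (u := fun _ : ℝ => u t) (w := fun _ : ℝ => w t) hk
      (huc.comp continuous_snd) (hw.comp continuous_snd) ε continuous_id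
  have hW := hmolc hkc hw
  have hW' := hmolc hd hw
  have key := energy_inequality_plane (K := K t) (N := N) (P := P) (Q := Q)
    (δ := 4 * (C * S * g t * ε)) hR hK0 (h.hasDerivAt t) hw
    (fun x => hasDerivAt_mol hk hw hε0.ne' x) (by fun_prop)
    (fun x => hasDerivAt_molFlux hk huc hw hε0.ne' x) hFD (h.nonneg t) hN
    (fun x hx => commutator_le hk hC hC' hε0 hw (h.hasDerivAt t) (hSx x hx) fun y => hg y x)
    hPle hQ
  have herr : 4 * (C * S * g t * ε) * (2 * (P + K t) + 4 * Q) ≤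
      4 * (C * S) * (4 * C * (1 + S) + 2 * κ + 4 * Q) * (g t * m) := by
    have e1 : 4 * (C * S * g t * ε) * (2 * (P + K t) + 4 * Q) =
        4 * (C * S * g t) * (4 * C * (1 + S) * m + ε * (2 * K t + 4 * Q)) := by
      rw [hP]; field_simp; ring
    have e2 : 4 * (C * S) * (4 * C * (1 + S) + 2 * κ + 4 * Q) * (g t * m) =
        4 * (C * S * g t) * (4 * C * (1 + S) * m + m * (2 * κ + 4 * Q)) := by ring
    rw [e1, e2]
    gcongr
  have hgc : Continuous fun p : ℝ × ℝ => molGap k w K ε t p.1 p.2 := by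
    unfold molGap
    fun_prop
  have f1 : ∀ F : ℝ → ℝ → ℝ, Continuous (Function.uncurry F) → ∀ c d : ℝ, ∀ x,
      IntervalIntegrable (F x) volume c d := fun F hF c d x =>
    (hF.comp (f := fun y => (x, y)) (by fun_prop)).intervalIntegrable _ _
  have f2 : ∀ F : ℝ → ℝ → ℝ, Continuous (Function.uncurry F) → ∀ c d p q : ℝ,
      IntervalIntegrable (fun x => ∫ y in c..d, F x y) volume p q := fun F hF c d p q =>
    (intervalIntegral.continuous_parametric_intervalIntegral_of_continuous' hF
      c d).intervalIntegrable _ _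
  have lin : ∀ (F G H : ℝ → ℝ → ℝ), Continuous (Function.uncurry F) →
      Continuous (Function.uncurry G) → Continuous (Function.uncurry H) → ∀ p q r : ℝ,
      (∫ x in (-R)..R, ∫ y in (-R)..R, (p * F x y + q * G x y + r * H x y)) =
      p * (∫ x in (-R)..R, ∫ y in (-R)..R, F x y) + q * (∫ x in (-R)..R, ∫ y in (-R)..R, G x y)
        + r * (∫ x in (-R)..R, ∫ y in (-R)..R, H x y) := by
    intro F G H hF hG hH p q r
    have : ∀ x, ∫ y in (-R)..R, (p * F x y + q * G x y + r * H x y) =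
        p * (∫ y in (-R)..R, F x y) + q * (∫ y in (-R)..R, G x y) +
          r * (∫ y in (-R)..R, H x y) := by
      intro x
      rw [intervalIntegral.integral_add (((f1 F hF _ _ x).const_mul p).add
        ((f1 G hG _ _ x).const_mul q)) ((f1 H hH _ _ x).const_mul r),
        intervalIntegral.integral_add ((f1 F hF _ _ x).const_mul p) ((f1 G hG _ _ x).const_mul q)]
      simp only [intervalIntegral.integral_const_mul]
    simp only [this]
    rw [intervalIntegral.integral_add (((f2 F hF _ _ _ _).const_mul p).add
        ((f2 G hG _ _ _ _).const_mul q)) ((f2 H hH _ _ _ _).const_mul r),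
        intervalIntegral.integral_add ((f2 F hF _ _ _ _).const_mul p)
          ((f2 G hG _ _ _ _).const_mul q)]
    simp only [intervalIntegral.integral_const_mul]
  set F1 : ℝ → ℝ → ℝ := fun x y => truncSqD (molGap k w K ε t x y) * bump R x * bump R y *
    (molFluxD k (u t) (w t) ε x - molFluxD k (u t) (w t) ε y) with hF1
  set F2 : ℝ → ℝ → ℝ := fun x y => truncSqD (molGap k w K ε t x y) * bump R x * bump R y *
    |w t x - w t y| with hF2
  set F3 : ℝ → ℝ → ℝ := fun x y => truncSqD (molGap k w K ε t x y) * bump R x * bump R y *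
    |x - y| with hF3
  have c1 : Continuous (Function.uncurry F1) := by
    simp only [hF1, Function.uncurry_def]; fun_prop
  have c2 : Continuous (Function.uncurry F2) := by
    simp only [hF2, Function.uncurry_def]; fun_prop
  have c3 : Continuous (Function.uncurry F3) := by
    simp only [hF3, Function.uncurry_def]; fun_prop
  have e1 := lin F1 F2 F3 c1 c2 c3 (1 / 2) 0 (-(K t ^ 2 / 2))
  have e2 := lin F1 F2 F3 c1 c2 c3 0 (K t / 2) (-(K t ^ 2 / 2))
  have e3 : (∫ x in (-R)..R, ∫ y in (-R)..R,
      truncSqD (molGap k w K ε t x y) * bump R x * bump R y *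
        (1 / 2 * molFluxD k (u t) (w t) ε x - 1 / 2 * molFluxD k (u t) (w t) ε y
          - K t ^ 2 / 2 * |x - y|)) =
      ∫ x in (-R)..R, ∫ y in (-R)..R, (1 / 2 * F1 x y + 0 * F2 x y + -(K t ^ 2 / 2) * F3 x y) := by
    congr 1; ext x; congr 1; ext y; simp only [hF1, hF2, hF3]; ring
  have e4 : (∫ x in (-R)..R, ∫ y in (-R)..R, truncSqD (molGap k w K ε t x y) * bump R x * bump R y *
      (K t / 2 * |w t x - w t y| - K t ^ 2 / 2 * |x - y|)) =
      ∫ x in (-R)..R, ∫ y in (-R)..R, (0 * F1 x y + K t / 2 * F2 x y + -(K t ^ 2 / 2) * F3 x y) := by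
    congr 1; ext x; congr 1; ext y; simp only [hF1, hF2, hF3]; ring
  unfold molForcing
  rw [e3, e4, e1, e2]
  change (∫ x in (-R)..R, ∫ y in (-R)..R, F1 x y) ≤ K t * (∫ x in (-R)..R, ∫ y in (-R)..R, F2 x y)
    + 16 / R ^ 2 * N * (∫ x in (-R)..R, ∫ y in (-R)..R, truncSq (molGap k w K ε t x y)) + _ at key
  have herr2 := mul_le_mul_of_nonneg_left herr (by positivity : 0 ≤ (2 * R) ^ 2)
  have e5 : 16 / R ^ 2 = 8 / R ^ 2 + 8 / R ^ 2 := by ring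
  rw [e5] at key
  linarith

/-- The total excess of `w t` over being `K t`-Lipschitz on `[-R, R]`. -/
def lipExcess (w : ℝ → ℝ → ℝ) (K : ℝ → ℝ) (R t : ℝ) : ℝ :=
  ∫ x in (-R)..R, ∫ y in (-R)..R, truncSq (w t x - w t y - K t * |x - y|)

lemma continuous_excess {w : ℝ → ℝ → ℝ} {K : ℝ → ℝ} (hw : Continuous (Function.uncurry w))
    (hK : Continuous K) :
    Continuous fun p : (ℝ × ℝ) × ℝ => w p.1.1 p.1.2 - w p.1.1 p.2 - K p.1.1 * |p.1.2 - p.2| := by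
  have h2 : Continuous fun p : (ℝ × ℝ) × ℝ => w p.1.1 p.1.2 :=
    hw.comp (f := fun p : (ℝ × ℝ) × ℝ => (p.1.1, p.1.2)) (by fun_prop)
  have h3 : Continuous fun p : (ℝ × ℝ) × ℝ => w p.1.1 p.2 :=
    hw.comp (f := fun p : (ℝ × ℝ) × ℝ => (p.1.1, p.2)) (by fun_prop)
  fun_prop

lemma continuous_excess_apply {w : ℝ → ℝ → ℝ} (hw : Continuous (Function.uncurry w)) (t c : ℝ) :
    Continuous fun p : ℝ × ℝ => w t p.1 - w t p.2 - c * |p.1 - p.2| :=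
  (continuous_excess hw (continuous_const (y := c))).comp
    (f := fun p : ℝ × ℝ => ((t, p.1), p.2)) (by fun_prop)

lemma continuous_lipExcess {w : ℝ → ℝ → ℝ} {K : ℝ → ℝ} (hw : Continuous (Function.uncurry w))
    (hK : Continuous K) (R : ℝ) : Continuous (lipExcess w K R) := by
  have := continuous_excess hw hK
  exact continuous_iterated_integral (by fun_prop) _ _ _ _

lemma iterated_integral_const (R c : ℝ) :
    (∫ _ in (-R)..R, ∫ _ in (-R)..R, c) = (2 * R) ^ 2 * c := by
  simp only [intervalIntegral.integral_const, smul_eq_mul]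
  ring

lemma IsFlow.sq_le {a b M : ℝ} {g : ℝ → ℝ} {u w : ℝ → ℝ → ℝ} (h : IsFlow a b M g u w) {t : ℝ}
    (hg : ∀ x y, |w t x - w t y| ≤ g t * |x - y|) (x : ℝ) : w t x ^ 2 ≤ 4 * g t * u t x := by
  have hg1 := h.one_le t
  have hg0 : 0 < g t := by linarith
  set s := -w t x / (2 * g t) with hs
  have h1 : ∀ y ∈ Icc (-|s|) |s|, ‖w t (x + y) - w t x‖ ≤ g t * |s| := fun y hy => by
    refine (hg _ _).trans ?_
    rw [add_sub_cancel_left]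
    exact mul_le_mul_of_nonneg_left (abs_le.2 hy) hg0.le
  have h2 := (convex_Icc (-|s|) |s|).norm_image_sub_le_of_norm_hasDerivWithin_le
    (f := fun y => u t (x + y) - w t x * y) (f' := fun y => w t (x + y) - w t x)
    (fun y _ => by
      refine HasDerivAt.hasDerivWithinAt ?_
      have e1 := (h.hasDerivAt t (x + y)).comp y ((hasDerivAt_id y).const_add x)
      exact (e1.sub ((hasDerivAt_id y).const_mul (w t x))).congr_deriv (by simp)) h1
    (show (0 : ℝ) ∈ Icc (-|s|) |s| from ⟨by simp, by simp⟩)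
    (show s ∈ Icc (-|s|) |s| from ⟨neg_abs_le s, le_abs_self s⟩)
  simp only [mul_zero, add_zero, sub_zero, Real.norm_eq_abs] at h2
  have h3 := (abs_le.1 h2).2
  have h4 := h.nonneg t (x + s)
  have h5 : w t x * s = -(w t x ^ 2 / (2 * g t)) := by rw [hs]; field_simp
  have h6 : g t * |s| * |s| = w t x ^ 2 / (4 * g t) := by
    rw [mul_assoc, abs_mul_abs_self, hs]
    field_simp
    ring
  have h7 : w t x ^ 2 / (2 * g t) = w t x ^ 2 / (4 * g t) + w t x ^ 2 / (4 * g t) := by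
    field_simp; ring
  have h8 : w t x ^ 2 / (4 * g t) ≤ u t x := by linarith
  rw [div_le_iff₀ (by positivity)] at h8
  linarith

lemma truncSq_excess_le {p q κ d : ℝ} (hκ : 0 ≤ κ) (hd : 0 ≤ d) :
    truncSq (p - q - κ * d) ≤ (p - q) ^ 2 := by
  rcases le_total (p - q - κ * d) 0 with h | h
  · rw [truncSq_of_nonpos h]; positivity
  · refine (truncSq_le_sq _).trans (pow_le_pow_left₀ h ?_ 2)
    have := mul_nonneg hκ hd
    linarith

lemma forcing_excess_le {p q κ d η : ℝ} (hκ : 0 ≤ κ) (hd : 0 ≤ d) (h1 : η ≤ 1) :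
    truncSqD (p - q - κ * d) * η * (κ / 2 * |p - q| - κ ^ 2 / 2 * d) ≤
      3 / 2 * κ * truncSq (p - q - κ * d) := by
  rcases le_total (p - q - κ * d) 0 with h | h
  · rw [truncSq_of_nonpos h, truncSqD_of_nonpos h]; simp
  · have hpq : 0 ≤ p - q := by
      have := mul_nonneg hκ hd
      linarith
    have h2 := mul_truncSqD_le (p - q - κ * d)
    rw [abs_of_nonneg hpq]
    calc truncSqD (p - q - κ * d) * η * (κ / 2 * (p - q) - κ ^ 2 / 2 * d)
        = κ / 2 * ((p - q - κ * d) * truncSqD (p - q - κ * d)) * η := by ring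
      _ ≤ κ / 2 * ((p - q - κ * d) * truncSqD (p - q - κ * d)) * 1 := by
        have := truncSqD_nonneg (p - q - κ * d)
        gcongr
      _ ≤ _ := by nlinarith

section

variable {a b M κ : ℝ} {g : ℝ → ℝ} {u w : ℝ → ℝ → ℝ} {K : ℝ → ℝ}

lemma IsFlow.mono (h : IsFlow a b M g u w) {c d : ℝ} (hac : a ≤ c) (hcd : c ≤ d) (hdb : d ≤ b) :
    IsFlow c d M g u w where
  continuous_left := h.continuous_left
  continuous_deriv := h.continuous_deriv
  hasDerivAt := h.hasDerivAt
  nonneg := h.nonneg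
  le_quad := h.le_quad
  integrable := h.integrable.mono_set (by
    rw [uIcc_of_le hcd, uIcc_of_le (hac.trans (hcd.trans hdb))]
    exact Icc_subset_Icc hac hdb)
  one_le := h.one_le
  lipschitz := by
    filter_upwards [h.lipschitz] with t ht hmem
    exact ht ⟨hac.trans_lt hmem.1, hmem.2.trans hdb⟩
  weak φ hφ hc s t hs hst ht := h.weak φ hφ hc s t (hac.trans hs) hst (ht.trans hdb)

lemma IsFlow.const_nonneg (h : IsFlow a b M g u w) : 0 ≤ M := by
  simpa using (h.nonneg 0 0).trans (h.le_quad 0 0)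

lemma molForcing_zero_le {k : ℝ → ℝ} (hk : ∫ z in (-1 : ℝ)..1, k z = 1) {R N t : ℝ} (hR : 0 < R)
    (hw : Continuous (Function.uncurry w)) (hK0 : 0 ≤ K t) :
    molForcing k w K R N 0 t ≤ (3 / 2 * K t + 8 / R ^ 2 * N) * lipExcess w K R t := by
  have hwt : Continuous (w t) := hw.comp (f := fun x => (t, x)) (by fun_prop)
  have hc := continuous_excess_apply hw t (K t)
  unfold molForcing molGap
  simp only [mol_zero hk]
  have : (∫ x in (-R)..R, ∫ y in (-R)..R, truncSqD (w t x - w t y - K t * |x - y|) * bump R x *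
      bump R y * (K t / 2 * |w t x - w t y| - K t ^ 2 / 2 * |x - y|)) ≤
      ∫ x in (-R)..R, ∫ y in (-R)..R, 3 / 2 * K t * truncSq (w t x - w t y - K t * |x - y|) := by
    refine intervalIntegral_iterated_mono (by fun_prop) (by fun_prop) (by linarith) ?_
    intro x hx y hy
    rw [mul_assoc (truncSqD _)]
    exact forcing_excess_le hK0 (abs_nonneg _)
      (mul_le_one₀ (bump_le_one hR hx) (bump_nonneg _ _) (bump_le_one hR hy))
  simp only [intervalIntegral.integral_const_mul] at this
  rw [add_mul]
  exact add_le_add_left this _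

lemma IsFlow.molEnergy_zero_le (h : IsFlow a b M g u w) {k : ℝ → ℝ} (hk : IsTest k)
    (hk1 : ∫ z in (-1 : ℝ)..1, k z = 1) (hK : Continuous K)
    (hK' : ∀ t ∈ Ioo a b, HasDerivAt K (K t ^ 2 / 2) t) (hK0 : ∀ t, 0 ≤ K t) (hKκ : ∀ t, K t ≤ κ)
    (ha : ∀ x y, w a x - w a y ≤ K a * |x - y|) {R : ℝ} (hR : 1 ≤ R) {t : ℝ} (ht : t ∈ Icc a b) :
    molEnergy k w K R 0 t ≤ (3 / 2 * κ + 16 * M) * ∫ r in a..t, lipExcess w K R r := by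
  have hM := h.const_nonneg
  have hk' := hk.continuous
  have hR0 : 0 < R := by linarith
  obtain ⟨C₁, hC₁⟩ := hk.hasCompactSupport.exists_bound_of_continuous hk.continuous
  obtain ⟨C₂, hC₂⟩ := hk.deriv.hasCompactSupport.exists_bound_of_continuous hk.deriv.continuous
  obtain ⟨S, hS⟩ := (isCompact_Icc (a := a) (b := b)).prod
    (isCompact_Icc (a := -(R + 1)) (b := R + 1)) |>.exists_bound_of_continuousOn
    h.continuous_deriv.continuousOn
  have hG := continuous_molGap hk.continuous h.continuous_deriv hK
  obtain ⟨Q, hQ⟩ := ((isCompact_Icc (a := (0 : ℝ)) (b := 1)).prod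
    (isCompact_Icc (a := a) (b := b))).prod (isCompact_Icc (a := -R) (b := R)) |>.prod
    (isCompact_Icc (a := -R) (b := R)) |>.exists_bound_of_continuousOn
    (continuous_truncSqD.comp hG).continuousOn
  have hN : ∀ t, ∀ x ∈ Icc (-R) R, u t x ≤ M * (R ^ 2 + 1) := fun t x hx => by
    refine (h.le_quad t x).trans ?_
    gcongr ?_ * (?_ + 1)
    exact sq_le_sq' hx.1 hx.2
  have h1 := sub_le_integral_of_perturbation (t := t)
    (c := (2 * R) ^ 2 * (4 * (max C₁ C₂ * S) * (4 * max C₁ C₂ * (1 + S) + 2 * κ + 4 * Q))) ht.1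
    (h.mono le_rfl ht.1 ht.2).integrable h.one_le
    (E := molEnergy k w K R) (H := molForcing k w K R (M * (R ^ 2 + 1)))
    (continuous_molEnergy hk.continuous h.continuous_deriv hK R)
    (continuous_molForcing hk.continuous h.continuous_deriv hK R _)
    (fun ε hε r hr => h.hasDerivAt_molEnergy hk hK hK' R hε.1 ⟨hr.1, hr.2.trans_le ht.2⟩) (by
      intro ε hε
      filter_upwards [h.lipschitz] with r hr hmem
      have hr' : r ∈ Icc a b := ⟨hmem.1.le, hmem.2.le.trans ht.2⟩
      exact h.molEnergy_deriv_le hk hR (fun z => (hC₁ z).trans (le_max_left _ _))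
        (fun z => (hC₂ z).trans (le_max_right _ _)) (fun y hy => hS (r, y) ⟨hr', hy⟩) (hN r)
        (hK0 r) (hKκ r) hε (hr ⟨hmem.1, hr'.2⟩)
        fun x hx y hy => (le_abs_self _).trans
          (hQ (((ε, r), x), y) ⟨⟨⟨⟨hε.1.le, hε.2⟩, hr'⟩, hx⟩, hy⟩))
  have h2 : molEnergy k w K R 0 a = 0 := by
    unfold molEnergy molGap
    simp only [mol_zero hk1]
    have : ∀ x y, truncSq (w a x - w a y - K a * |x - y|) = 0 := fun x y =>
      truncSq_of_nonpos (by linarith [ha x y])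
    simp [this]
  rw [h2, sub_zero] at h1
  refine h1.trans ?_
  rw [← intervalIntegral.integral_const_mul]
  have cE := continuous_lipExcess h.continuous_deriv hK R
  refine intervalIntegral.integral_mono_on ht.1 (Continuous.intervalIntegrable
    ((continuous_molForcing hk.continuous h.continuous_deriv hK R _).comp
      (f := fun r => (0, r)) (by fun_prop)) _ _) (Continuous.intervalIntegrable
    (by fun_prop) _ _) fun r _ => ?_
  refine (molForcing_zero_le hk1 hR0 h.continuous_deriv (hK0 r)).trans ?_
  have e0 : 0 ≤ lipExcess w K R r := by
    refine intervalIntegral.integral_nonneg (by linarith) fun x _ =>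
      intervalIntegral.integral_nonneg (by linarith) fun y _ => truncSq_nonneg _
  refine mul_le_mul_of_nonneg_right ?_ e0
  refine add_le_add (by linarith [hKκ r]) ?_
  rw [div_mul_eq_mul_div, div_le_iff₀ (by positivity)]
  nlinarith [mul_nonneg hM (by nlinarith : 0 ≤ R ^ 2 - 1)]

lemma lipExcess_nonneg {R : ℝ} (hR : 0 ≤ R) (t : ℝ) : 0 ≤ lipExcess w K R t :=
  intervalIntegral.integral_nonneg (by linarith) fun _ _ =>
    intervalIntegral.integral_nonneg (by linarith) fun _ _ => truncSq_nonneg _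

lemma bump_two_mul_ge {R x : ℝ} (hR : 0 < R) (hx : x ∈ Icc (-R) R) : 1 / 2 ≤ bump (2 * R) x := by
  have h1 := sq_div_sq_le_one hR hx
  have h2 : x ^ 2 / (2 * R) ^ 2 = x ^ 2 / R ^ 2 / 4 := by field_simp; norm_num
  unfold bump
  rw [h2]
  nlinarith

lemma intervalIntegral_iterated_mono_set {F : ℝ → ℝ → ℝ} (hF : Continuous (Function.uncurry F))
    (h0 : ∀ x y, 0 ≤ F x y) {R S : ℝ} (hR : 0 ≤ R) (hRS : R ≤ S) :
    (∫ x in (-R)..R, ∫ y in (-R)..R, F x y) ≤ ∫ x in (-S)..S, ∫ y in (-S)..S, F x y := by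
  have f1 : ∀ x c d, IntervalIntegrable (F x) volume c d := fun x c d =>
    (hF.comp (f := fun y => (x, y)) (by fun_prop)).intervalIntegrable _ _
  have f2 : ∀ c d p q : ℝ, IntervalIntegrable (fun x => ∫ y in c..d, F x y) volume p q :=
    fun c d p q => (intervalIntegral.continuous_parametric_intervalIntegral_of_continuous' hF
      c d).intervalIntegrable _ _
  calc (∫ x in (-R)..R, ∫ y in (-R)..R, F x y) ≤ ∫ x in (-R)..R, ∫ y in (-S)..S, F x y := by
        refine intervalIntegral.integral_mono_on (by linarith) (f2 _ _ _ _) (f2 _ _ _ _)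
          fun x _ => ?_
        exact intervalIntegral.integral_mono_interval (by linarith) (by linarith) hRS
          (Eventually.of_forall fun y => h0 x y) (f1 _ _ _)
    _ ≤ _ := by
        refine intervalIntegral.integral_mono_interval (by linarith) (by linarith) hRS
          (Eventually.of_forall fun x => ?_) (f2 _ _ _ _)
        exact intervalIntegral.integral_nonneg (by linarith) fun y _ => h0 x y

lemma lipExcess_le_molEnergy {k : ℝ → ℝ} (hk1 : ∫ z in (-1 : ℝ)..1, k z = 1)
    (hw : Continuous (Function.uncurry w)) {R : ℝ} (hR : 0 < R) (t : ℝ) :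
    lipExcess w K R t ≤ 4 * molEnergy k w K (2 * R) 0 t := by
  have hc := continuous_excess_apply hw t (K t)
  unfold molEnergy molGap
  simp only [mol_zero hk1]
  calc lipExcess w K R t ≤ ∫ x in (-R)..R, ∫ y in (-R)..R,
        4 * (truncSq (w t x - w t y - K t * |x - y|) * bump (2 * R) x * bump (2 * R) y) := by
        refine intervalIntegral_iterated_mono (by fun_prop) (by fun_prop) (by linarith) ?_
        intro x hx y hy
        have h1 := bump_two_mul_ge hR hx
        have h2 := bump_two_mul_ge hR hy
        have h3 := truncSq_nonneg (w t x - w t y - K t * |x - y|)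
        have h4 : 1 / 4 ≤ bump (2 * R) x * bump (2 * R) y := by nlinarith
        nlinarith
    _ = 4 * ∫ x in (-R)..R, ∫ y in (-R)..R,
        truncSq (w t x - w t y - K t * |x - y|) * bump (2 * R) x * bump (2 * R) y := by
        simp only [intervalIntegral.integral_const_mul]
    _ ≤ _ := by
        refine mul_le_mul_of_nonneg_left ?_ (by norm_num)
        refine intervalIntegral_iterated_mono_set
          (F := fun x y => truncSq (w t x - w t y - K t * |x - y|) * bump (2 * R) x *
            bump (2 * R) y) (by simp only [Function.uncurry_def]; fun_prop) (fun x y => ?_) hR.le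
            (by linarith)
        exact mul_nonneg (mul_nonneg (truncSq_nonneg _) (bump_nonneg _ _)) (bump_nonneg _ _)

lemma IsFlow.lipExcess_le_of_lipschitz (h : IsFlow a b M g u w) {t : ℝ} (hK0 : 0 ≤ K t)
    (hg : ∀ x y, |w t x - w t y| ≤ g t * |x - y|) {R : ℝ} (hR : 1 ≤ R) :
    lipExcess w K R t ≤ 128 * M * R ^ 4 * g t := by
  have hM := h.const_nonneg
  have hg1 := h.one_le t
  have hc := continuous_excess_apply h.continuous_deriv t (K t)
  have h1 : lipExcess w K R t ≤ ∫ _ in (-R)..R, ∫ _ in (-R)..R, 32 * M * R ^ 2 * g t := by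
    refine intervalIntegral_iterated_mono (by fun_prop) (by fun_prop) (by linarith) ?_
    have hu : ∀ x ∈ Icc (-R) R, u t x ≤ 2 * M * R ^ 2 := fun x hx => by
      refine (h.le_quad t x).trans ?_
      have : x ^ 2 ≤ R ^ 2 := sq_le_sq' hx.1 hx.2
      nlinarith [mul_le_mul_of_nonneg_left (by nlinarith : x ^ 2 + 1 ≤ 2 * R ^ 2) hM]
    intro x hx y hy
    refine (truncSq_excess_le hK0 (abs_nonneg _)).trans ?_
    have e1 := h.sq_le hg x
    have e2 := h.sq_le hg y
    have e3 := mul_le_mul_of_nonneg_left (hu x hx) (by linarith : 0 ≤ g t)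
    have e4 := mul_le_mul_of_nonneg_left (hu y hy) (by linarith : 0 ≤ g t)
    nlinarith [sq_nonneg (w t x + w t y)]
  refine h1.trans (le_of_eq ?_)
  rw [iterated_integral_const]
  ring

lemma IsFlow.lipExcess_eq_zero (h : IsFlow a b M g u w) (hK : Continuous K)
    (hK' : ∀ t ∈ Ioo a b, HasDerivAt K (K t ^ 2 / 2) t) (hK0 : ∀ t, 0 ≤ K t) (hKκ : ∀ t, K t ≤ κ)
    (ha : ∀ x y, w a x - w a y ≤ K a * |x - y|) {R : ℝ} (hR : 1 ≤ R) {t : ℝ} (ht : t ∈ Icc a b) :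
    lipExcess w K R t = 0 := by
  obtain ⟨k, hk, hk1⟩ := exists_isTest_integral_eq_one
  have hM := h.const_nonneg
  have hκ : 0 ≤ κ := (hK0 0).trans (hKκ 0)
  set A := 3 / 2 * κ + 16 * M with hA
  have hA0 : 0 ≤ A := by positivity
  have hcE := continuous_lipExcess h.continuous_deriv hK
  have step : ∀ R, 1 ≤ R → ∀ t ∈ Icc a b,
      lipExcess w K R t ≤ 4 * A * ∫ r in a..t, lipExcess w K (2 * R) r := by
    intro R hR t ht
    refine (lipExcess_le_molEnergy hk1 h.continuous_deriv (by linarith) t).trans ?_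
    rw [mul_assoc]
    exact mul_le_mul_of_nonneg_left
      (h.molEnergy_zero_le hk hk1 hK hK' hK0 hKκ ha (by linarith) ht) (by norm_num)
  have hab : a ≤ b := ht.1.trans ht.2
  set G := ∫ r in a..b, g r with hG
  have base : ∀ R, 1 ≤ R → ∀ t ∈ Icc a b,
      lipExcess w K R t ≤ 4 * A * (128 * M * 16 * G) * R ^ 4 := by
    intro R hR t ht
    refine (step R hR t ht).trans ?_
    rw [mul_assoc (4 * A)]
    refine mul_le_mul_of_nonneg_left ?_ (by positivity)
    have hgi := (h.mono le_rfl ht.1 ht.2).integrable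
    calc ∫ r in a..t, lipExcess w K (2 * R) r
        ≤ ∫ r in a..t, 128 * M * (2 * R) ^ 4 * g r := by
          refine intervalIntegral.integral_mono_ae_restrict ht.1
            ((hcE _).intervalIntegrable _ _) (hgi.const_mul _) ?_
          rw [EventuallyLE, ae_restrict_iff' measurableSet_Icc]
          filter_upwards [h.lipschitz, compl_mem_ae_iff.2 (measure_singleton a)] with r hr hra hmem
          refine h.lipExcess_le_of_lipschitz (hK0 r) (hr ⟨?_, hmem.2.trans ht.2⟩) (by linarith)
          exact lt_of_le_of_ne hmem.1 (Ne.symm hra)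
      _ = 128 * M * (2 * R) ^ 4 * ∫ r in a..t, g r := intervalIntegral.integral_const_mul _ _
      _ ≤ 128 * M * (2 * R) ^ 4 * G := by
          gcongr
          exact intervalIntegral.integral_mono_interval le_rfl ht.1 ht.2
            (Eventually.of_forall fun r => zero_le_one.trans (h.one_le r)) h.integrable
      _ = _ := by ring
  set C₀ := 4 * A * (128 * M * 16 * G) with hC₀
  have iter : ∀ n : ℕ, ∀ R, 1 ≤ R → ∀ t ∈ Icc a b,
      lipExcess w K R t ≤ C₀ * R ^ 4 * ((64 * A * (t - a)) ^ n / n.factorial) := by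
    intro n
    induction n with
    | zero => intro R hR t ht; simpa using base R hR t ht
    | succ n ih =>
      intro R hR t ht
      refine (step R hR t ht).trans ?_
      have hi : ∫ r in a..t, (r - a) ^ n = (t - a) ^ (n + 1) / (n + 1) := by
        rw [intervalIntegral.integral_comp_sub_right (fun r => r ^ n) a, integral_pow]
        simp
      calc 4 * A * ∫ r in a..t, lipExcess w K (2 * R) r
          ≤ 4 * A * ∫ r in a..t, C₀ * (2 * R) ^ 4 * ((64 * A) ^ n / n.factorial) * (r - a) ^ n := by
            refine mul_le_mul_of_nonneg_left ?_ (by positivity)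
            refine intervalIntegral.integral_mono_on ht.1 ((hcE _).intervalIntegrable _ _)
              (Continuous.intervalIntegrable (by fun_prop) _ _) fun r hr => ?_
            refine (ih (2 * R) (by linarith) r ⟨hr.1, hr.2.trans ht.2⟩).trans (le_of_eq ?_)
            rw [mul_pow (64 * A)]; ring
        _ = _ := by
            rw [intervalIntegral.integral_const_mul, hi, Nat.factorial_succ, mul_pow (64 * A)]
            push_cast
            have : (n.factorial : ℝ) ≠ 0 := by positivity
            have : (n : ℝ) + 1 ≠ 0 := by positivity
            field_simp
            ring
  refine le_antisymm ?_ (lipExcess_nonneg (by linarith) t)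
  have ht' := (FloorSemiring.tendsto_pow_div_factorial_atTop (64 * A * (t - a))).const_mul
    (C₀ * R ^ 4)
  rw [mul_zero] at ht'
  exact ge_of_tendsto' ht' fun n => iter n R hR t ht

lemma IsFlow.sub_le_of_comparison (h : IsFlow a b M g u w) (hK : Continuous K)
    (hK' : ∀ t ∈ Ioo a b, HasDerivAt K (K t ^ 2 / 2) t) (hK0 : ∀ t, 0 ≤ K t) (hKκ : ∀ t, K t ≤ κ)
    (ha : ∀ x y, w a x - w a y ≤ K a * |x - y|) {t : ℝ} (ht : t ∈ Icc a b) (x y : ℝ) :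
    w t x - w t y ≤ K t * |x - y| := by
  set R := 1 + |x| + |y| with hR
  have hx0 := abs_nonneg x
  have hy0 := abs_nonneg y
  have hx : x ∈ Icc (-R) R := abs_le.1 (by linarith)
  have hy : y ∈ Icc (-R) R := abs_le.1 (by linarith)
  have h0 := h.lipExcess_eq_zero hK hK' hK0 hKκ ha (R := R) (by linarith) ht
  have hc := continuous_excess_apply h.continuous_deriv t (K t)
  by_contra! hlt
  have hpos : 0 < truncSq (w t x - w t y - K t * |x - y|) := by
    refine lt_of_le_of_ne (truncSq_nonneg _) fun h => ?_
    have := nonpos_of_truncSq_eq_zero h.symm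
    linarith
  have h1 : 0 < ∫ y in (-R)..R, truncSq (w t x - w t y - K t * |x - y|) :=
    intervalIntegral.integral_pos (by linarith) (Continuous.continuousOn
      (continuous_truncSq.comp (hc.comp (f := fun y => (x, y)) (by fun_prop))))
      (fun _ _ => truncSq_nonneg _) ⟨y, hy, hpos⟩
  have h2 : 0 < lipExcess w K R t :=
    intervalIntegral.integral_pos (by linarith) (Continuous.continuousOn
      (intervalIntegral.continuous_parametric_intervalIntegral_of_continuous'
        (f := fun x y => truncSq (w t x - w t y - K t * |x - y|))
        (continuous_truncSq.comp hc) _ _))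
      (fun x _ => intervalIntegral.integral_nonneg (by linarith) fun y _ => truncSq_nonneg _)
      ⟨x, hx, h1⟩
  exact h2.ne' h0

/-- Propagation of Lipschitz bounds along the Riccati equation `K' = K² / 2`. -/
lemma IsFlow.lipschitz_of_lipschitz (h : IsFlow a b M g u w) (hab : a ≤ b) {L : ℝ} (hL : 0 < L)
    (hlt : (b - a) / 2 < L⁻¹) (ha : ∀ x y, |w a x - w a y| ≤ L * |x - y|) {t : ℝ}
    (ht : t ∈ Icc a b) (x y : ℝ) : |w t x - w t y| ≤ (L⁻¹ - (t - a) / 2)⁻¹ * |x - y| := by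
  set p : ℝ := L⁻¹ - (b - a) / 2 with hp
  have hp0 : 0 < p := by linarith
  set K : ℝ → ℝ := fun t => (max p (L⁻¹ - (t - a) / 2))⁻¹ with hK
  have hmax : ∀ t, 0 < max p (L⁻¹ - (t - a) / 2) := fun t => lt_max_of_lt_left hp0
  have hKc : Continuous K := by
    refine Continuous.inv₀ (by fun_prop) fun t => (hmax t).ne'
  have hKe : ∀ t ≤ b, K t = (L⁻¹ - (t - a) / 2)⁻¹ := fun t ht => by
    simp only [hK]
    rw [max_eq_right (by linarith)]
  have hK' : ∀ t ∈ Ioo a b, HasDerivAt K (K t ^ 2 / 2) t := by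
    intro t ht
    have h0 : L⁻¹ - (t - a) / 2 ≠ 0 := by linarith [ht.2]
    have e1 := ((((hasDerivAt_id t).sub_const a).div_const 2).const_sub L⁻¹).inv h0
    have e2 : HasDerivAt K _ t := e1.congr_of_eventuallyEq (by
      filter_upwards [Iio_mem_nhds ht.2] with s hs
      exact hKe s (le_of_lt hs))
    refine e2.congr_deriv ?_
    rw [hKe t ht.2.le]
    simp only [id]
    field_simp
  have hKa : K a = L := by rw [hKe a hab]; simp
  have key : ∀ x y, w t x - w t y ≤ K t * |x - y| := fun x y =>
    h.sub_le_of_comparison (κ := p⁻¹) hKc hK' (fun t => (inv_pos.2 (hmax t)).le)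
      (fun t => inv_anti₀ hp0 (le_max_left _ _))
      (fun x y => by rw [hKa]; exact (le_abs_self _).trans (ha x y)) ht x y
  rw [← hKe t ht.2, abs_le]
  refine ⟨?_, key x y⟩
  have := key y x
  rw [abs_sub_comm] at this
  linarith

end

/-- On a compact time interval, a Lipschitz bound on the initial space derivative persists: it can
only blow up at rate `2 / (τ - t)`, which is not integrable. -/
lemma IsFlow.exists_lipschitz {a b M L₀ : ℝ} {g : ℝ → ℝ} {u w : ℝ → ℝ → ℝ}
    (h : IsFlow a b M g u w) (hab : a ≤ b) (ha : ∀ x y, |w a x - w a y| ≤ L₀ * |x - y|) :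
    ∃ L, ∀ t ∈ Icc a b, ∀ x y, |w t x - w t y| ≤ L * |x - y| := by
  set S : Set ℝ := {t | t ∈ Icc a b ∧ ∃ L, ∀ s ∈ Icc a t, ∀ x y, |w s x - w s y| ≤ L * |x - y|}
    with hS
  have haS : a ∈ S := ⟨⟨le_rfl, hab⟩, L₀, fun s hs => by
    rw [le_antisymm hs.2 hs.1]; exact ha⟩
  have hSb : BddAbove S := ⟨b, fun t ht => ht.1.2⟩
  set τ := sSup S with hτ
  have haτ : a ≤ τ := le_csSup hSb haS
  have hτb : τ ≤ b := csSup_le ⟨a, haS⟩ fun t ht => ht.1.2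
  have hlt : ∀ t, a ≤ t → t < τ → t ∈ S := by
    intro t hat htτ
    obtain ⟨s, hs, hts⟩ := exists_lt_of_lt_csSup ⟨a, haS⟩ htτ
    obtain ⟨L, hL⟩ := hs.2
    exact ⟨⟨hat, hts.le.trans hs.1.2⟩, L, fun r hr => hL r ⟨hr.1, hr.2.trans hts.le⟩⟩
  obtain ⟨t, L, htS, htτ, hL0, htL, hL⟩ : ∃ t L, t ∈ S ∧ t ≤ τ ∧ 0 < L ∧ (τ - t) / 2 < L⁻¹ ∧
      ∀ x y, |w t x - w t y| ≤ L * |x - y| := by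
    rcases haτ.eq_or_lt with h0 | h0
    · refine ⟨a, max L₀ 1, haS, haτ, by positivity, ?_, fun x y => (ha x y).trans ?_⟩
      · rw [← h0, sub_self, zero_div]; positivity
      · gcongr; exact le_max_left _ _
    · by_contra! hcon
      have hi : IntervalIntegrable (fun t => (t - τ)⁻¹) volume a τ := by
        refine (h.mono le_rfl haτ hτb).integrable.mono_fun'
          ((measurable_id.sub_const τ).inv.aestronglyMeasurable) ?_
        rw [EventuallyLE, uIoc_of_le haτ, ae_restrict_iff' measurableSet_Ioc]
        filter_upwards [h.lipschitz, compl_mem_ae_iff.2 (measure_singleton τ)] with t ht htτ hmem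
        have htlt : t < τ := lt_of_le_of_ne hmem.2 htτ
        have hg := h.one_le t
        have hg0 : 0 < g t := by linarith
        by_contra! hgt
        obtain ⟨x, y, hxy⟩ := hcon t (g t) (hlt t hmem.1.le htlt) hmem.2 hg0 (by
          have h1 : 0 < τ - t := by linarith
          rw [Real.norm_eq_abs, abs_inv, abs_sub_comm, abs_of_pos h1] at hgt
          have := (lt_inv_comm₀ hg0 h1).1 hgt
          linarith)
        exact absurd (ht ⟨hmem.1, hmem.2.trans hτb⟩ x y) (not_le.2 hxy)
      rw [intervalIntegrable_sub_inv_iff] at hi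
      rcases hi with hi | hi
      · exact h0.ne hi
      · exact hi right_mem_uIcc
  obtain ⟨c, hc1, hc2⟩ := exists_between (show τ < t + 2 * L⁻¹ by linarith)
  set d := min b c with hd
  have htd : t ≤ d := le_min htS.1.2 (by linarith)
  have hdb : d ≤ b := min_le_left _ _
  have hdL : (d - t) / 2 < L⁻¹ := by
    have := min_le_right b c
    linarith
  have hext := fun s hs => (h.mono htS.1.1 htd hdb).lipschitz_of_lipschitz htd hL0 hdL hL (t := s) hs
  have hdS : d ∈ S := by
    obtain ⟨L₁, hL₁⟩ := htS.2
    refine ⟨⟨htS.1.1.trans htd, hdb⟩, max L₁ (L⁻¹ - (d - t) / 2)⁻¹, fun s hs x y => ?_⟩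
    rcases le_total s t with hst | hst
    · refine (hL₁ s ⟨hs.1, hst⟩ x y).trans ?_
      gcongr
      exact le_max_left _ _
    · refine (hext s ⟨hst, hs.2⟩ x y).trans ?_
      gcongr
      refine le_max_of_le_right (inv_anti₀ (by linarith) ?_)
      linarith [hs.2]
  have hdτ : d ≤ τ := le_csSup hSb hdS
  have hdb' : d = b := by
    rcases min_choice b c with h1 | h1
    · exact h1
    · exact absurd hdτ (not_le.2 (by rw [hd, h1]; exact hc1))
  rw [hdb'] at hdS
  exact hdS.2

section

variable {T T' : ℝ} {u : ℝ → ℝ → ℝ}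

lemma RegWeak.eventually_le (h : RegWeak T u) {t₀ : ℝ} (ht₀ : t₀ ∈ Ico 0 T) {R η : ℝ} (hR : 0 < R)
    (hη : 0 < η) : ∀ᶠ t in nhdsWithin t₀ (Ico 0 T), ∀ x ∈ Icc (-R) R,
      |u t x - u t₀ x| + |deriv (u t) x - deriv (u t₀) x| ≤ η := by
  obtain ⟨-, hL, ht⟩ := h
  have hbd : ∀ t ∈ Ico 0 T, ∃ B, ∀ x ∈ Icc (-R) R, |u t x| ≤ B ∧ |deriv (u t) x| ≤ B := by
    intro t ht
    obtain ⟨L, hL⟩ := hL t ht (R + 1) (by linarith)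
    obtain ⟨B, hB⟩ := (isCompact_Icc (a := -R) (b := R)).exists_bound_of_continuousOn
      (hL.continuousOn.mono (Icc_subset_Icc (by linarith) (by linarith)))
    refine ⟨max B L, fun x hx => ⟨(hB x hx).trans (le_max_left _ _), le_trans ?_ (le_max_right _ _)⟩⟩
    exact norm_deriv_le_of_lipschitzOn (Icc_mem_nhds (by linarith [hx.1]) (by linarith [hx.2])) hL
  have h1 := (ht t₀ ht₀ R hR).eventually (gt_mem_nhds hη)
  filter_upwards [h1, self_mem_nhdsWithin] with t ht1 ht2 x hx
  obtain ⟨B₁, hB₁⟩ := hbd t ht2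
  obtain ⟨B₂, hB₂⟩ := hbd t₀ ht₀
  refine (le_ciSup (f := fun x : Icc (-R) R =>
    |u t x.1 - u t₀ x.1| + |deriv (u t) x.1 - deriv (u t₀) x.1|) ?_ ⟨x, hx⟩).trans ht1.le
  refine ⟨2 * (B₁ + B₂), ?_⟩
  rintro _ ⟨y, rfl⟩
  have e1 := hB₁ y y.2
  have e2 := hB₂ y y.2
  have e3 := abs_sub (u t y) (u t₀ y)
  have e4 := abs_sub (deriv (u t) y) (deriv (u t₀) y)
  simp only
  linarith [e1.1, e1.2, e2.1, e2.2]

lemma IsStrongSolution.contDiff (h : IsStrongSolution T u) {t₀ : ℝ} (ht₀ : t₀ ∈ Ico 0 T) :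
    Differentiable ℝ (u t₀) ∧ Continuous (deriv (u t₀)) := by
  obtain ⟨T', h1, h2⟩ := exists_between ht₀.2
  obtain ⟨g, -, hg⟩ := (h.2 T' (ht₀.1.trans_lt h1) h2).2
  set G : Set ℝ := {t | Differentiable ℝ (u t) ∧ Differentiable ℝ (deriv (u t))} with hG
  have hfreq : ∃ᶠ t in nhdsWithin t₀ (Ioi t₀), t ∈ G := by
    intro hev
    obtain ⟨c, hc, hsub⟩ := mem_nhdsGT_iff_exists_Ioo_subset.1 hev
    rw [ae_restrict_iff' measurableSet_Ioc] at hg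
    have hz : volume (Ioo t₀ (min c T')) = 0 := by
      refine measure_mono_null ?_ (ae_iff.1 hg)
      intro t ht hcon
      refine hsub ⟨ht.1, ht.2.trans_le (min_le_left _ _)⟩ ?_
      have := hcon ⟨ht₀.1.trans_lt ht.1, ht.2.le.trans (min_le_right _ _)⟩
      exact ⟨fun x => (this.1 x).1, fun x => (this.1 x).2⟩
    rw [Real.volume_Ioo, ENNReal.ofReal_eq_zero] at hz
    have := lt_min (mem_Ioi.1 hc) h1
    linarith
  set l : Filter ℝ := nhdsWithin t₀ (Ioi t₀) ⊓ principal G with hl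
  have hne : l.NeBot := frequently_mem_iff_neBot.1 hfreq
  have hlG : ∀ᶠ t in l, t ∈ G := mem_inf_of_right (mem_principal_self G)
  have hle : l ≤ nhdsWithin t₀ (Ico 0 T) := by
    refine inf_le_left.trans ?_
    rw [nhdsWithin_le_iff]
    filter_upwards [Ioo_mem_nhdsGT ht₀.2] with t ht
    exact ⟨ht₀.1.trans ht.1.le, ht.2⟩
  have hun : ∀ R : ℝ, 0 < R → TendstoUniformlyOn (fun t => deriv (u t)) (deriv (u t₀)) l
      (Ioo (-R) R) := by
    intro R hR
    rw [Metric.tendstoUniformlyOn_iff]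
    intro η hη
    filter_upwards [hle (h.1.2.1.eventually_le ht₀ hR (half_pos hη))] with t ht x hx
    have h3 := ht x (Ioo_subset_Icc_self hx)
    rw [dist_comm, Real.dist_eq]
    linarith [abs_nonneg (u t x - u t₀ x)]
  have hpt : ∀ x, Tendsto (fun t => u t x) l (nhds (u t₀ x)) := by
    intro x
    rw [Metric.tendsto_nhds]
    intro η hη
    have hR : 0 < |x| + 1 := by positivity
    filter_upwards [hle (h.1.2.1.eventually_le ht₀ hR (half_pos hη))] with t ht
    have h3 := ht x (abs_le.1 (by linarith))
    rw [Real.dist_eq]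
    linarith [abs_nonneg (deriv (u t) x - deriv (u t₀) x)]
  have hmem : ∀ x : ℝ, x ∈ Ioo (-(|x| + 1)) (|x| + 1) := fun x => abs_lt.1 (by linarith)
  refine ⟨fun x => ?_, continuous_iff_continuousAt.2 fun x => ?_⟩
  · refine (hasDerivAt_of_tendstoUniformlyOn isOpen_Ioo (hun (|x| + 1) (by positivity)) ?_
      (fun y _ => hpt y) (hmem x)).differentiableAt
    filter_upwards [hlG] with t ht y _ using (ht.1 y).hasDerivAt
  · refine ((hun (|x| + 1) (by positivity)).continuousOn ?_).continuousAt
      (Ioo_mem_nhds (hmem x).1 (hmem x).2)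
    exact (hlG.mono fun t ht => ht.2.continuous.continuousOn).frequently

lemma IsStrongSolution.continuousOn_deriv (h : IsStrongSolution T u) :
    ContinuousOn (Function.uncurry fun t => deriv (u t)) (Ico 0 T ×ˢ (univ : Set ℝ)) := by
  rintro ⟨t₀, x₀⟩ ⟨ht₀, -⟩
  rw [ContinuousWithinAt, nhdsWithin_prod_eq, nhdsWithin_univ, Metric.tendsto_nhds]
  intro η hη
  have hR : 0 < |x₀| + 1 := by positivity
  have h1 := h.1.2.1.eventually_le ht₀ hR (half_pos (half_pos hη))
  have h2 : ∀ᶠ x in nhds x₀, |deriv (u t₀) x - deriv (u t₀) x₀| < η / 2 :=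
    Metric.tendsto_nhds.1 (h.contDiff ht₀).2.continuousAt (η / 2) (half_pos hη)
  have h3 : ∀ᶠ x in nhds x₀, x ∈ Icc (-(|x₀| + 1)) (|x₀| + 1) := by
    have := abs_lt.1 (lt_add_one |x₀|)
    exact Icc_mem_nhds this.1 this.2
  filter_upwards [h1.prod_mk (h2.and h3)] with p hp
  have e1 := hp.1 p.2 hp.2.2
  have e2 := hp.2.1
  have e3 := abs_sub_le (deriv (u p.1) p.2) (deriv (u t₀) p.2) (deriv (u t₀) x₀)
  have e4 := abs_nonneg (u p.1 p.2 - u t₀ p.2)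
  simp only [Function.uncurry, Real.dist_eq]
  linarith

/-- The projection of `t` onto `[0, T']`. -/
def clamp (T' t : ℝ) : ℝ := max 0 (min t T')

lemma clamp_mem (hT' : 0 ≤ T') (t : ℝ) : clamp T' t ∈ Icc 0 T' :=
  ⟨le_max_left _ _, max_le hT' (min_le_right _ _)⟩

lemma clamp_of_mem {t : ℝ} (ht : t ∈ Icc 0 T') : clamp T' t = t := by
  rw [clamp, min_eq_left ht.2, max_eq_right ht.1]

lemma continuous_clamp : Continuous (clamp T') := by unfold clamp; fun_prop

lemma continuous_uncurry_clamp {f : ℝ → ℝ → ℝ} (hT' : 0 ≤ T') (hTT : T' < T)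
    (hf : ContinuousOn (Function.uncurry f) (Ico 0 T ×ˢ (univ : Set ℝ))) :
    Continuous (Function.uncurry fun t => f (clamp T' t)) := by
  have hc := continuous_clamp (T' := T')
  exact hf.comp_continuous (f := fun p : ℝ × ℝ => (clamp T' p.1, p.2)) (by fun_prop)
    fun p => ⟨⟨(clamp_mem hT' p.1).1, (clamp_mem hT' p.1).2.trans_lt hTT⟩, mem_univ _⟩

/-- A continuous function whose integral against the derivative of every admissible cutoff vanishes
is zero. -/
lemma eq_zero_of_integral_deriv_mul {k : ℝ → ℝ} (hk : Continuous k) (hT' : 0 < T')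
    (h : ∀ χ : ℝ → ℝ, ContDiff ℝ (⊤ : ℕ∞) χ → Function.support χ ⊆ Icc (-1) T' →
      ∫ t in (0 : ℝ)..T', deriv χ t * k t = 0) {t : ℝ} (ht : t ∈ Icc 0 T') : k t = 0 := by
  have hae : ∀ᵐ t, t ∈ Ioo 0 T' → k t = 0 := by
    refine isOpen_Ioo.ae_eq_zero_of_integral_contDiff_smul_eq_zero
      (hk.locallyIntegrable.locallyIntegrableOn _) fun θ hθ _ hθs => ?_
    have hθc : Continuous θ := hθ.continuous
    set I : ℝ → ℝ := fun t => ∫ s in T'..t, θ s with hI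
    have hId : ∀ t, HasDerivAt I (θ t) t := fun t =>
      intervalIntegral.integral_hasDerivAt_right (hθc.intervalIntegrable _ _)
        (hθc.stronglyMeasurableAtFilter _ _) hθc.continuousAt
    have hIs : ContDiff ℝ (⊤ : ℕ∞) I := by
      rw [contDiff_infty_iff_deriv]
      refine ⟨fun t => (hId t).differentiableAt, ?_⟩
      rw [show deriv I = θ from funext fun t => (hId t).deriv]
      exact hθ
    have hθz : ∀ t, t ∉ Ioo 0 T' → θ t = 0 := fun t ht =>
      image_eq_zero_of_notMem_tsupport fun h' => ht (hθs h')
    have hIz : ∀ t, T' ≤ t → I t = 0 := by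
      intro t ht
      refine intervalIntegral.integral_zero_ae (Eventually.of_forall fun s hs => hθz s fun hs' => ?_)
      rw [uIoc_of_le ht] at hs
      exact absurd hs.1 (not_lt.2 hs'.2.le)
    set χ : ℝ → ℝ := fun t => Real.smoothTransition (t + 1) * I t with hχ
    have hχs : ContDiff ℝ (⊤ : ℕ∞) χ :=
      (Real.smoothTransition.contDiff.comp (contDiff_id.add contDiff_const)).mul hIs
    have hsupp : Function.support χ ⊆ Icc (-1) T' := by
      intro t ht
      by_contra hcon
      refine ht ?_
      simp only [hχ]
      rcases le_total t T' with h1 | h1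
      · have h2 : t < -1 := by
          by_contra! h2
          exact hcon ⟨h2, h1⟩
        rw [Real.smoothTransition.zero_of_nonpos (by linarith), zero_mul]
      · rw [hIz t h1, mul_zero]
    have hd : ∀ t, 0 < t → deriv χ t = θ t := by
      intro t ht
      refine HasDerivAt.deriv ((hId t).congr_of_eventuallyEq ?_)
      filter_upwards [lt_mem_nhds ht] with s hs
      simp only [hχ]
      rw [Real.smoothTransition.one_of_one_le (by linarith), one_mul]
    have h1 := h χ hχs hsupp
    rw [intervalIntegral.integral_of_le hT'.le] at h1
    rw [← h1, ← setIntegral_eq_integral_of_forall_compl_eq_zero (s := Ioc 0 T')]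
    · refine setIntegral_congr_fun measurableSet_Ioc fun t ht => ?_
      simp only [smul_eq_mul, hd t ht.1]
    · intro t ht
      rw [hθz t fun h' => ht ⟨h'.1, h'.2.le⟩, zero_smul]
  have h2 : k =ᵐ[volume.restrict (Icc 0 T')] fun _ => 0 := by
    rw [← restrict_Ioo_eq_restrict_Icc, EventuallyEq, ae_restrict_iff' measurableSet_Ioo]
    exact hae
  exact Measure.eqOn_Icc_of_ae_eq volume hT'.ne h2 hk.continuousOn continuousOn_const ht

lemma IsStrongSolution.weak_clamp (h : IsStrongSolution T u) (hT' : 0 < T') (hTT : T' < T)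
    {φ : ℝ → ℝ} (hφ : ContDiff ℝ (⊤ : ℕ∞) φ) (hφc : HasCompactSupport φ) {s t : ℝ}
    (hs : 0 ≤ s) (hst : s ≤ t) (ht : t ≤ T') :
    (∫ x, u (clamp T' t) x * φ x) - ∫ x, u (clamp T' s) x * φ x =
      ∫ r in s..t, ∫ x, -(1 / 2) * ((deriv φ x * u (clamp T' r) x +
        φ x * deriv (u (clamp T' r)) x) * deriv (u (clamp T' r)) x) := by
  set v : ℝ → ℝ → ℝ := fun t => u (clamp T' t) with hv
  set w : ℝ → ℝ → ℝ := fun t => deriv (u (clamp T' t)) with hw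
  have cv : Continuous (Function.uncurry v) := continuous_uncurry_clamp hT'.le hTT h.1.2.1.1
  have cw : Continuous (Function.uncurry w) :=
    continuous_uncurry_clamp hT'.le hTT h.continuousOn_deriv
  have cvt : ∀ t, Continuous (v t) := fun t => cv.comp (f := fun x => (t, x)) (by fun_prop)
  have cwt : ∀ t, Continuous (w t) := fun t => cw.comp (f := fun x => (t, x)) (by fun_prop)
  have cφ := hφ.continuous
  have cφ' : Continuous (deriv φ) := hφ.continuous_deriv (by simp)
  have hφz : ∀ x, x ∉ tsupport φ → φ x = 0 := fun x => image_eq_zero_of_notMem_tsupport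
  have hφz' : ∀ x, x ∉ tsupport φ → deriv φ x = 0 := fun x hx =>
    image_eq_zero_of_notMem_tsupport fun h' => hx (tsupport_deriv_subset h')
  set f : ℝ → ℝ := fun t => ∫ x, v t x * φ x with hf
  set q : ℝ → ℝ := fun t => ∫ x, -(1 / 2) * ((deriv φ x * v t x + φ x * w t x) * w t x) with hq
  have cpar : ∀ F : ℝ → ℝ → ℝ, Continuous (Function.uncurry F) →
      (∀ t, ∀ x, x ∉ tsupport φ → F t x = 0) → Continuous fun t => ∫ x, F t x := by
    intro F hF hz
    rw [← continuousOn_univ]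
    exact continuousOn_integral_of_compact_support hφc hF.continuousOn fun t x _ hx => hz t x hx
  have cf : Continuous f := cpar _ (by simp only [Function.uncurry_def] at cv ⊢; fun_prop)
    fun t x hx => by rw [hφz x hx, mul_zero]
  have cq : Continuous q := cpar _ (by simp only [Function.uncurry_def] at cv cw ⊢; fun_prop)
    fun t x hx => by rw [hφz x hx, hφz' x hx]; ring
  set H : ℝ → ℝ := fun t => ∫ r in (0 : ℝ)..t, q r with hH
  have hHd : ∀ t, HasDerivAt H (q t) t := fun t =>
    intervalIntegral.integral_hasDerivAt_right (cq.intervalIntegrable _ _)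
      (cq.stronglyMeasurableAtFilter _ _) cq.continuousAt
  have cH : Continuous H := continuous_iff_continuousAt.2 fun t => (hHd t).continuousAt
  have key : ∀ t ∈ Icc 0 T', f t - f 0 - H t = 0 := by
    intro t ht
    refine eq_zero_of_integral_deriv_mul (k := fun t => f t - f 0 - H t) (by fun_prop) hT' ?_ ht
    intro χ hχ hsupp
    have hts : tsupport χ ⊆ Icc (-1) T' := closure_minimal hsupp isClosed_Icc
    have cχ := hχ.continuous
    have cχ' : Continuous (deriv χ) := hχ.continuous_deriv (by simp)
    have hχd : ∀ t, HasDerivAt χ (deriv χ t) t := fun t =>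
      ((hχ.differentiable (by simp)) t).hasDerivAt
    have hχz : ∀ t, T' < t → χ t = 0 := fun t ht => by
      by_contra hne
      exact absurd (hsupp hne).2 (not_le.2 ht)
    have hχz' : ∀ t, T' < t → deriv χ t = 0 := fun t ht =>
      image_eq_zero_of_notMem_tsupport fun h' =>
        absurd (hts (tsupport_deriv_subset h')).2 (not_le.2 ht)
    have hχT : χ T' = 0 := by
      have : closure (Ioi T') ⊆ {t | χ t = 0} :=
        closure_minimal (fun t ht => hχz t ht) (isClosed_eq cχ continuous_const)
      rw [closure_Ioi] at this
      exact this self_mem_Ici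
    have hψs : Function.support (Function.uncurry fun t x => χ t * φ x) ⊆
        Icc (-1) T' ×ˢ tsupport φ := by
      rintro ⟨t, x⟩ hp
      have hp' : χ t * φ x ≠ 0 := hp
      exact ⟨hsupp (left_ne_zero_of_mul hp'), subset_tsupport φ (right_ne_zero_of_mul hp')⟩
    have hψt : tsupport (Function.uncurry fun t x => χ t * φ x) ⊆ Icc (-1) T' ×ˢ tsupport φ :=
      closure_minimal hψs (isClosed_Icc.prod (isClosed_tsupport φ))
    have h1 := h.1.2.2 (fun t x => χ t * φ x)
      ((hχ.comp contDiff_fst).mul (hφ.comp contDiff_snd))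
      (HasCompactSupport.of_support_subset_isCompact (isCompact_Icc.prod hφc) hψs)
      (hψt.trans (prod_mono (fun t ht => ht.2.trans_lt hTT) (subset_univ _)))
    have hin : ∀ t ∈ Icc 0 T', (∫ x : ℝ, (u t x * deriv (fun s => χ s * φ x) t
          - (1/2) * deriv (fun y => χ t * φ y * u t y) x * deriv (u t) x)) =
        deriv χ t * f t + χ t * q t := by
      intro t ht
      have hvt : u t = v t := by simp only [hv, clamp_of_mem ht]
      have hwt : deriv (u t) = w t := by simp only [hw, clamp_of_mem ht]
      have hut := (h.contDiff ⟨ht.1, ht.2.trans_lt hTT⟩).1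
      have e1 : ∀ x, deriv (fun s => χ s * φ x) t = deriv χ t * φ x := fun x =>
        ((hχd t).mul_const _).deriv
      have e2 : ∀ x, deriv (fun y => χ t * φ y * u t y) x =
          χ t * (deriv φ x * u t x + φ x * deriv (u t) x) := fun x => by
        have hφx := ((hφ.differentiable (by simp)) x).hasDerivAt
        have e : HasDerivAt (fun y => χ t * φ y * u t y) _ x :=
          (hφx.const_mul (χ t)).mul (hut x).hasDerivAt
        rw [e.deriv]
        ring
      simp only [e1, e2]
      rw [hwt, hvt]
      have i1 : Integrable fun x => v t x * φ x :=
        Continuous.integrable_of_hasCompactSupport ((cvt t).mul cφ) hφc.mul_left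
      have i2 : Integrable fun x => -(1 / 2) * ((deriv φ x * v t x + φ x * w t x) * w t x) := by
        have := cvt t
        have := cwt t
        refine Continuous.integrable_of_hasCompactSupport (by fun_prop)
          (HasCompactSupport.intro hφc fun x hx => ?_)
        rw [hφz x hx, hφz' x hx]; ring
      rw [hf, hq, ← integral_const_mul, ← integral_const_mul,
        ← integral_add (i1.const_mul _) (i2.const_mul _)]
      congr 1; ext x; ring
    have hI : ∫ t in Ico (0:ℝ) T, ∫ x : ℝ, (u t x * deriv (fun s => χ s * φ x) t
          - (1/2) * deriv (fun y => χ t * φ y * u t y) x * deriv (u t) x) =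
        ∫ t in (0:ℝ)..T', (deriv χ t * f t + χ t * q t) := by
      rw [intervalIntegral.integral_of_le hT'.le, ← integral_Icc_eq_integral_Ioc,
        ← setIntegral_congr_fun measurableSet_Icc hin]
      refine setIntegral_eq_of_subset_of_forall_sdiff_eq_zero measurableSet_Ico
        (fun t ht => ⟨ht.1, ht.2.trans_lt hTT⟩) fun t ht => ?_
      have htT : T' < t := by
        by_contra! hcon
        exact ht.2 ⟨ht.1.1, hcon⟩
      have e1 : ∀ x, deriv (fun s => χ s * φ x) t = 0 := fun x => by
        rw [((hχd t).mul_const _).deriv, hχz' t htT, zero_mul]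
      simp only [e1, hχz t htT]
      simp
    rw [hI] at h1
    have hf0 : ∫ x, u 0 x * (χ 0 * φ x) = χ 0 * f 0 := by
      simp only [hf, hv]
      rw [clamp_of_mem (show (0 : ℝ) ∈ Icc 0 T' from ⟨le_rfl, hT'.le⟩), ← integral_const_mul]
      congr 1; ext x; ring
    rw [hf0] at h1
    have p1 : ∫ t in (0:ℝ)..T', χ t * q t = -∫ t in (0:ℝ)..T', deriv χ t * H t := by
      rw [intervalIntegral.integral_mul_deriv_eq_deriv_mul (fun t _ => hχd t) (fun t _ => hHd t)
        (cχ'.intervalIntegrable _ _) (cq.intervalIntegrable _ _), hχT]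
      simp [hH]
    have p2 : ∫ t in (0:ℝ)..T', deriv χ t = -χ 0 := by
      rw [intervalIntegral.integral_eq_sub_of_hasDerivAt (fun t _ => hχd t)
        (cχ'.intervalIntegrable _ _), hχT, zero_sub]
    have j : ∀ F : ℝ → ℝ, Continuous F → IntervalIntegrable F volume 0 T' := fun F hF =>
      hF.intervalIntegrable _ _
    rw [intervalIntegral.integral_add (j _ (by fun_prop)) (j _ (by fun_prop)), p1] at h1
    simp only [mul_sub]
    rw [intervalIntegral.integral_sub (j _ (by fun_prop)) (j _ (by fun_prop)),
      intervalIntegral.integral_sub (j _ (by fun_prop)) (j _ (by fun_prop)),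
      intervalIntegral.integral_mul_const, p2]
    linarith
  have k1 := key t ⟨hs.trans hst, ht⟩
  have k2 := key s ⟨hs, hst.trans ht⟩
  have k3 := intervalIntegral.integral_interval_sub_left (cq.intervalIntegrable (μ := volume) 0 t)
    (cq.intervalIntegrable 0 s)
  change f t - f s = ∫ r in s..t, q r
  rw [← k3]
  simp only [hH] at k1 k2
  linarith

lemma IsStrongSolution.exists_isFlow (h : IsStrongSolution T u) (hT' : 0 < T') (hTT : T' < T) :
    ∃ M g, IsFlow 0 T' M g (fun t => u (clamp T' t)) (fun t => deriv (u (clamp T' t))) := by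
  obtain ⟨⟨M, hM⟩, g, hg, hgae⟩ := h.2 T' hT' hTT
  have hmem : ∀ t, clamp T' t ∈ Ico 0 T := fun t =>
    ⟨(clamp_mem hT'.le t).1, (clamp_mem hT'.le t).2.trans_lt hTT⟩
  refine ⟨M, fun t => |g t| + 1, ?_⟩
  refine ⟨continuous_uncurry_clamp hT'.le hTT h.1.2.1.1,
    continuous_uncurry_clamp hT'.le hTT h.continuousOn_deriv,
    fun t x => ((h.contDiff (hmem t)).1 x).hasDerivAt, fun t x => h.1.1 _ (hmem t) x,
    fun t x => hM _ (clamp_mem hT'.le t) x, ?_, fun t => by linarith [abs_nonneg (g t)], ?_,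
    fun φ hφ hφc s t hs hst ht => h.weak_clamp hT' hTT hφ hφc hs hst ht⟩
  · rw [intervalIntegrable_iff_integrableOn_Icc_of_le hT'.le]
    exact hg.abs.add (by simp)
  · rw [ae_restrict_iff' measurableSet_Ioc] at hgae
    filter_upwards [hgae] with t ht hmem x y
    obtain ⟨h1, h2⟩ := ht hmem
    rw [clamp_of_mem ⟨hmem.1.le, hmem.2⟩]
    have h3 := convex_univ.norm_image_sub_le_of_norm_deriv_le (f := deriv (u t)) (C := |g t| + 1)
      (fun z _ => (h1 z).2) (fun z _ => (h2 z).trans (by linarith [le_abs_self (g t)]))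
      (mem_univ y) (mem_univ x)
    exact h3

end

/-- A strong solution on `[0,T)` is differentiable in space for
every `t ∈ (0,T)`, and `∂ₓ u(t,·)` is Lipschitz uniformly on each `[T₁,T₂] ⊂ (0,T)`;
if moreover `u(0,·)` is differentiable with Lipschitz derivative, the same holds
with `T₁ = 0`. -/
theorem strong_interior_regularity
    (T : ℝ) (u : ℝ → ℝ → ℝ) (hu : IsStrongSolution T u) :
    (∀ t ∈ Ioo (0:ℝ) T, Differentiable ℝ (u t)) ∧
    (∀ T₁ T₂ : ℝ, 0 < T₁ → T₁ ≤ T₂ → T₂ < T →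
      ∃ M : NNReal, ∀ t ∈ Icc T₁ T₂, LipschitzWith M (deriv (u t))) ∧
    ((Differentiable ℝ (u 0) ∧ ∃ L : NNReal, LipschitzWith L (deriv (u 0))) →
      ∀ T₂ : ℝ, 0 ≤ T₂ → T₂ < T →
        ∃ M : NNReal, ∀ t ∈ Icc (0:ℝ) T₂, LipschitzWith M (deriv (u t))) := by
  have main : ∀ {M g a b}, 0 ≤ a → a ≤ b → IsFlow a b M g (fun t => u (clamp b t))
      (fun t => deriv (u (clamp b t))) →
      (∃ L, ∀ x y, |deriv (u a) x - deriv (u a) y| ≤ L * |x - y|) →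
      ∃ M : NNReal, ∀ t ∈ Icc a b, LipschitzWith M (deriv (u t)) := by
    intro M g a b ha hab hflow ⟨L, hL⟩
    obtain ⟨L₁, hL₁⟩ := hflow.exists_lipschitz (L₀ := L) hab (by
      simp only [clamp_of_mem (show a ∈ Icc 0 b from ⟨ha, hab⟩)]
      exact hL)
    refine ⟨L₁.toNNReal, fun t ht => LipschitzWith.of_dist_le_mul fun x y => ?_⟩
    have := hL₁ t ht x y
    rw [clamp_of_mem ⟨ha.trans ht.1, ht.2⟩] at this
    exact this.trans (mul_le_mul_of_nonneg_right (Real.le_coe_toNNReal _) (abs_nonneg _))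
  refine ⟨fun t ht => (hu.contDiff ⟨ht.1.le, ht.2⟩).1, ?_, ?_⟩
  · intro T₁ T₂ h1 h12 h2
    obtain ⟨M, g, hflow⟩ := hu.exists_isFlow (h1.trans_le h12) h2
    obtain ⟨a, ha, hlip⟩ : ∃ a ∈ Ioo 0 T₁, ∀ x y,
        |deriv (u (clamp T₂ a)) x - deriv (u (clamp T₂ a)) y| ≤ g a * |x - y| := by
      by_contra! hcon
      have hz : volume (Ioo 0 T₁) = 0 := by
        refine measure_mono_null ?_ (ae_iff.1 hflow.lipschitz)
        intro t ht hlip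
        obtain ⟨x, y, hxy⟩ := hcon t ht
        exact absurd (hlip ⟨ht.1, ht.2.le.trans h12⟩ x y) (not_le.2 hxy)
      rw [Real.volume_Ioo, ENNReal.ofReal_eq_zero] at hz
      linarith
    rw [clamp_of_mem ⟨ha.1.le, ha.2.le.trans h12⟩] at hlip
    obtain ⟨L, hL⟩ := main ha.1.le (ha.2.le.trans h12)
      (hflow.mono ha.1.le (ha.2.le.trans h12) le_rfl) ⟨_, hlip⟩
    exact ⟨L, fun t ht => hL t ⟨ha.2.le.trans ht.1, ht.2⟩⟩
  · rintro ⟨-, L, hL⟩ T₂ h0 h2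
    obtain ⟨T₃, h3, h4⟩ := exists_between h2
    obtain ⟨M, g, hflow⟩ := hu.exists_isFlow (h0.trans_lt h3) h4
    obtain ⟨L₁, hL₁⟩ := main le_rfl (h0.trans h3.le) hflow ⟨L, fun x y => hL.dist_le_mul x y⟩
    exact ⟨L₁, fun t ht => hL₁ t ⟨ht.1, ht.2.trans h3.le⟩⟩
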